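/- arXiv:1305.1719 — 2 statements merged into one kernel-verified Lean document; each statement's English description precedes it below -/
import Mathlib

section
/- Fix an integer d ≥ 2n−1. For every s ∈ {0,1,…,n}, the module Ext^{2s}_S(I^d, S) is nonzero. -/
open MvPolynomial

section ExtSupport

open CategoryTheory

variable {S : Type} [CommRing S]

/-- The module `Ext^j(M, S)` vanishes after localizing at the prime `p`. -/
def ExtVanishes (p : PrimeSpectrum S) (M : ModuleCat.{0} S) (j : ℕ) : Prop :=
  p ∉ Module.support S (Abelian.Ext M (ModuleCat.of S S) j)

lemma extVanishes_iff {p : PrimeSpectrum S} {M : ModuleCat.{0} S} {j : ℕ} :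
    ExtVanishes p M j ↔
      ∀ x : Abelian.Ext M (ModuleCat.of S S) j, ∃ r ∉ p.asIdeal, r • x = 0 :=
  Module.notMem_support_iff'

section ShortExact

variable {p : PrimeSpectrum S} {T : ShortComplex (ModuleCat.{0} S)} {j : ℕ}

lemma ExtVanishes.middle (hT : T.ShortExact)
    (h₁ : ExtVanishes p T.X₁ j) (h₃ : ExtVanishes p T.X₃ j) :
    ExtVanishes p T.X₂ j := by
  rw [extVanishes_iff] at *
  intro x
  obtain ⟨r, hr, hrx⟩ := h₁ ((Abelian.Ext.mk₀ T.f).comp x (zero_add j))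
  obtain ⟨z, hz⟩ := Abelian.Ext.contravariant_sequence_exact₂ hT _
    (r • x) (by rw [Abelian.Ext.comp_smul]; exact hrx)
  obtain ⟨t, ht, htz⟩ := h₃ z
  refine ⟨t * r, p.2.mul_notMem ht hr, ?_⟩
  rw [mul_smul, ← hz, ← Abelian.Ext.comp_smul, htz, Abelian.Ext.comp_zero]

lemma ExtVanishes.left (hT : T.ShortExact)
    (h₂ : ExtVanishes p T.X₂ j) (h₃ : ExtVanishes p T.X₃ (j + 1)) :
    ExtVanishes p T.X₁ j := by
  rw [extVanishes_iff] at *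
  intro x
  obtain ⟨r, hr, hrx⟩ := h₃ (hT.extClass.comp x (add_comm 1 j))
  obtain ⟨z, hz⟩ := Abelian.Ext.contravariant_sequence_exact₁ hT _
    (r • x) (add_comm 1 j) (by rw [Abelian.Ext.comp_smul]; exact hrx)
  obtain ⟨t, ht, htz⟩ := h₂ z
  refine ⟨t * r, p.2.mul_notMem ht hr, ?_⟩
  rw [mul_smul, ← hz, ← Abelian.Ext.comp_smul, htz, Abelian.Ext.comp_zero]

lemma ExtVanishes.right (hT : T.ShortExact)
    (h₁ : ExtVanishes p T.X₁ j) (h₂ : ExtVanishes p T.X₂ (j + 1)) :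
    ExtVanishes p T.X₃ (j + 1) := by
  rw [extVanishes_iff] at *
  intro x
  obtain ⟨r, hr, hrx⟩ := h₂ ((Abelian.Ext.mk₀ T.g).comp x (zero_add _))
  obtain ⟨z, hz⟩ := Abelian.Ext.contravariant_sequence_exact₃ hT _
    (r • x) (by rw [Abelian.Ext.comp_smul]; exact hrx) (add_comm 1 j)
  obtain ⟨t, ht, htz⟩ := h₁ z
  refine ⟨t * r, p.2.mul_notMem ht hr, ?_⟩
  rw [mul_smul, ← hz, ← Abelian.Ext.comp_smul, htz, Abelian.Ext.comp_zero]

end ShortExact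

/-- Nakayama for multiplication by an element of `p` which is injective on `M`. -/
lemma ExtVanishes.of_smul [IsNoetherianRing S] {p : PrimeSpectrum S} {M N : ModuleCat.{0} S}
    [Module.Finite S M] {a : S} {f : M ⟶ M} (hf : f = a • 𝟙 M) {g : M ⟶ N} {w : f ≫ g = 0}
    (hT : (ShortComplex.mk f g w).ShortExact)
    (ha : a ∈ p.asIdeal) {j : ℕ} (h₃ : ExtVanishes p N (j + 1)) : ExtVanishes p M j := by
  have key : p ∉ Module.support S (QuotSMulTop a (Abelian.Ext M (ModuleCat.of S S) j)) := by
    rw [Module.notMem_support_iff']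
    intro x
    obtain ⟨x, rfl⟩ := Submodule.Quotient.mk_surjective _ x
    obtain ⟨r, hr, hrx⟩ := extVanishes_iff.1 h₃ (hT.extClass.comp x (add_comm 1 j))
    obtain ⟨z, hz⟩ := Abelian.Ext.contravariant_sequence_exact₁ hT _
      (r • x) (add_comm 1 j) (by rw [Abelian.Ext.comp_smul]; exact hrx)
    refine ⟨r, hr, ?_⟩
    rw [← Submodule.Quotient.mk_smul, Submodule.Quotient.mk_eq_zero]
    change r • x ∈ _
    rw [← hz]
    dsimp only
    rw [hf, Abelian.Ext.mk₀_smul, Abelian.Ext.smul_comp, Abelian.Ext.mk₀_id_comp]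
    exact Submodule.smul_mem_pointwise_smul _ _ _ trivial
  rw [Module.support_quotSMulTop] at key
  intro hp
  exact key ⟨hp, by simpa [PrimeSpectrum.mem_zeroLocus] using ha⟩

/-- The Ext module `Ext^j(S/J, S)` vanishes after localizing at the prime `p`. -/
abbrev ExtVanishesAt (p : PrimeSpectrum S) (J : Ideal S) (j : ℕ) : Prop :=
  ExtVanishes p (ModuleCat.of S (S ⧸ J)) j

/-- Multiplication by `a` as a map `S/L → S/J`, where `L = (J : a)`. -/
def colonMul {J L : Ideal S} {a : S} (h : ∀ f, f ∈ L ↔ a * f ∈ J) : (S ⧸ L) →ₗ[S] (S ⧸ J) :=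
  Submodule.mapQ L J (LinearMap.mulLeft S a) fun f hf => (h f).1 hf

lemma colonMul_comp {J L : Ideal S} {a : S} (h : ∀ f, f ∈ L ↔ a * f ∈ J) :
    (Submodule.factor (le_sup_left : J ≤ J ⊔ Ideal.span {a})) ∘ₗ colonMul h = 0 := by
  refine LinearMap.ext fun x => ?_
  obtain ⟨x, rfl⟩ := Ideal.Quotient.mk_surjective x
  exact (Submodule.Quotient.mk_eq_zero _).2
    (Ideal.mem_sup_right (Ideal.mul_mem_right x _ (Ideal.mem_span_singleton_self a)))

/-- The complex `S/(J : a) → S/J → S/(J + (a))`. -/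
noncomputable def colonComplex {J L : Ideal S} {a : S} (h : ∀ f, f ∈ L ↔ a * f ∈ J) :
    ShortComplex (ModuleCat.{0} S) :=
  ModuleCat.shortComplexOfCompEqZero (colonMul h) _ (colonMul_comp h)

lemma colonComplex_shortExact {J L : Ideal S} {a : S} (h : ∀ f, f ∈ L ↔ a * f ∈ J) :
    (colonComplex h).ShortExact := by
  apply ModuleCat.shortComplex_shortExact
  · intro y
    obtain ⟨y, rfl⟩ := Ideal.Quotient.mk_surjective y
    constructor
    · intro hy
      have hy' : y ∈ J ⊔ Ideal.span {a} := (Submodule.Quotient.mk_eq_zero _).1 hy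
      obtain ⟨u, hu, v, hv, huv⟩ := Submodule.mem_sup.1 hy'
      obtain ⟨w, rfl⟩ := Ideal.mem_span_singleton.1 hv
      refine ⟨Ideal.Quotient.mk L w, ?_⟩
      refine (Submodule.Quotient.eq _).2 ?_
      have : a * w - y = -u := by rw [← huv]; ring
      exact this ▸ J.neg_mem hu
    · rintro ⟨x, hx⟩
      rw [← hx]
      exact LinearMap.congr_fun (colonMul_comp h) x
  · change Function.Injective (colonMul h)
    rw [injective_iff_map_eq_zero]
    intro x hx
    obtain ⟨x, rfl⟩ := Ideal.Quotient.mk_surjective x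
    exact Ideal.Quotient.eq_zero_iff_mem.2 ((h x).2 ((Submodule.Quotient.mk_eq_zero _).1 hx))
  · exact Submodule.factor_surjective (le_sup_left : J ≤ J ⊔ Ideal.span {a})

variable {p : PrimeSpectrum S} {J L : Ideal S} {a : S}

lemma ExtVanishesAt.middle (h : ∀ f, f ∈ L ↔ a * f ∈ J) {j : ℕ}
    (h₁ : ExtVanishesAt p L j) (h₃ : ExtVanishesAt p (J ⊔ Ideal.span {a}) j) :
    ExtVanishesAt p J j :=
  ExtVanishes.middle (colonComplex_shortExact h) h₁ h₃

lemma ExtVanishesAt.left (h : ∀ f, f ∈ L ↔ a * f ∈ J) {j : ℕ}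
    (h₂ : ExtVanishesAt p J j) (h₃ : ExtVanishesAt p (J ⊔ Ideal.span {a}) (j + 1)) :
    ExtVanishesAt p L j :=
  ExtVanishes.left (colonComplex_shortExact h) h₂ h₃

lemma ExtVanishesAt.right (h : ∀ f, f ∈ L ↔ a * f ∈ J) {j : ℕ}
    (h₁ : ExtVanishesAt p L j) (h₂ : ExtVanishesAt p J (j + 1)) :
    ExtVanishesAt p (J ⊔ Ideal.span {a}) (j + 1) :=
  ExtVanishes.right (colonComplex_shortExact h) h₁ h₂

/-- Nakayama for an element of `p` which is regular on `S/J`. -/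
lemma ExtVanishesAt.of_regular [IsNoetherianRing S] (h : ∀ f, f ∈ J ↔ a * f ∈ J)
    (ha : a ∈ p.asIdeal) {j : ℕ} (h₃ : ExtVanishesAt p (J ⊔ Ideal.span {a}) (j + 1)) :
    ExtVanishesAt p J j := by
  have hf : ModuleCat.ofHom (colonMul h) = a • 𝟙 (ModuleCat.of S (S ⧸ J)) := by
    ext
    rfl
  exact ExtVanishes.of_smul hf (colonComplex_shortExact h) ha h₃

lemma extVanishesAt_of_notMem {r : S} (hr : r ∉ p.asIdeal) (hrJ : r ∈ J) (j : ℕ) :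
    ExtVanishesAt p J j := by
  rw [ExtVanishesAt, extVanishes_iff]
  intro x
  refine ⟨r, hr, ?_⟩
  have : r • 𝟙 (ModuleCat.of S (S ⧸ J)) = 0 := by
    refine ModuleCat.hom_ext (LinearMap.ext fun x => ?_)
    obtain ⟨x, rfl⟩ := Ideal.Quotient.mk_surjective x
    exact Ideal.Quotient.eq_zero_iff_mem.2 (J.mul_mem_right _ hrJ)
  have smul_eq : r • x = (Abelian.Ext.mk₀ (r • 𝟙 (ModuleCat.of S (S ⧸ J)))).comp x
    (zero_add j) := by simp [Abelian.Ext.mk₀_smul]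
  rw [smul_eq, this, Abelian.Ext.mk₀_zero, Abelian.Ext.zero_comp]

/-- If the groups `Ext^i(S/p, S)_p` vanish for `i > h` then so do all `Ext^i(S/J, S)_p`. -/
lemma extVanishesAt_of_prime [IsNoetherianRing S] {h : ℕ}
    (hp : ∀ i, h < i → ExtVanishesAt p p.asIdeal i) (J : Ideal S) :
    ∀ i, h < i → ExtVanishesAt p J i := by
  refine IsNoetherian.induction (P := fun J : Ideal S => ∀ i, h < i → ExtVanishesAt p J i)
    (fun (J : Ideal S) ih => ?_) J
  by_cases hJp : J ≤ p.asIdeal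
  swap
  · obtain ⟨r, hrJ, hr⟩ := SetLike.not_le_iff_exists.1 hJp
    exact fun i _ => extVanishesAt_of_notMem hr hrJ i
  have hgt : ∀ {a}, a ∉ J → J < J ⊔ Ideal.span {a} := fun ha =>
    lt_of_le_of_ne le_sup_left fun he =>
      ha (he ▸ Ideal.mem_sup_right (Ideal.mem_span_singleton_self _))
  by_cases hJ : J.IsPrime
  · rcases hJp.eq_or_lt with rfl | hlt
    · exact hp
    · obtain ⟨a, hap, haJ⟩ := SetLike.exists_of_lt hlt
      intro i hi
      refine ExtVanishesAt.of_regular (a := a)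
        (fun f => ⟨fun hf => J.mul_mem_left _ hf, fun hf => (hJ.mem_or_mem hf).resolve_left haJ⟩)
        hap (ih _ (hgt haJ) _ (by omega))
  · have hJt : J ≠ ⊤ := fun he => p.2.ne_top (top_le_iff.1 (he ▸ hJp))
    rw [Ideal.isPrime_iff] at hJ
    push Not at hJ
    obtain ⟨a, b, hab, ha, hb⟩ := hJ hJt
    intro i hi
    let L : Ideal S := Submodule.comap (LinearMap.mulLeft S a) J
    have hL : ∀ f, f ∈ L ↔ a * f ∈ J := fun f => Iff.rfl
    refine ExtVanishesAt.middle hL (ih L ?_ i hi) (ih _ (hgt ha) i hi)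
    exact SetLike.lt_iff_le_and_exists.2
      ⟨fun f hf => J.mul_mem_left _ hf, b, hab, hb⟩

/-- The elements of `V`, in any order, form a weakly regular sequence modulo `J`. -/
def IsPermutableRegular {R : Type*} [CommRing R] [DecidableEq R] (J : Ideal R) (V : Finset R) :
    Prop :=
  ∀ F : Finset R, ∀ a, insert a F ⊆ V → a ∉ F →
    ∀ f, a * f ∈ J ⊔ Ideal.span (F : Set R) → f ∈ J ⊔ Ideal.span (F : Set R)

lemma IsPermutableRegular.mem_iff [DecidableEq S] {V F : Finset S} (hV : IsPermutableRegular J V)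
    (hF : insert a F ⊆ V) (ha : a ∉ F) (f : S) :
    f ∈ J ⊔ Ideal.span (F : Set S) ↔ a * f ∈ J ⊔ Ideal.span (F : Set S) :=
  ⟨fun hf => Ideal.mul_mem_left _ _ hf, hV F a hF ha f⟩

lemma sup_span_insert [DecidableEq S] (F : Finset S) :
    J ⊔ Ideal.span ((insert a F : Finset S) : Set S) =
      J ⊔ Ideal.span (F : Set S) ⊔ Ideal.span {a} := by
  rw [Finset.coe_insert, Ideal.span_insert, sup_assoc, sup_comm (Ideal.span {a})]

/-- The Koszul computation of `Ext(S/(V), S)` for a regular sequence `V` in `p`. -/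
lemma extVanishesAt_span [DecidableEq S] [IsNoetherianRing S] [IsDomain S] {V : Finset S}
    (hV : IsPermutableRegular ⊥ V) (hVp : ∀ v ∈ V, v ∈ p.asIdeal) (F : Finset S) (hF : F ⊆ V) :
    (∀ i, F.card < i → ExtVanishesAt p (⊥ ⊔ Ideal.span (F : Set S)) i) ∧
      ¬ ExtVanishesAt p (⊥ ⊔ Ideal.span (F : Set S)) F.card := by
  induction F using Finset.induction_on with
  | empty =>
    let e : (S ⧸ (⊥ ⊔ Ideal.span ((∅ : Finset S) : Set S))) ≃ₗ[S] S :=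
      Submodule.quotEquivOfEqBot _ (by simp)
    have : Projective (ModuleCat.of S (S ⧸ (⊥ ⊔ Ideal.span ((∅ : Finset S) : Set S)))) :=
      have := Module.Projective.of_equiv e.symm
      inferInstance
    constructor
    · intro i hi
      rw [ExtVanishesAt, extVanishes_iff]
      intro x
      refine ⟨1, p.1.ne_top_iff_one.1 p.2.ne_top, ?_⟩
      obtain ⟨i, rfl⟩ : ∃ k, i = k + 1 := ⟨i - 1, by simp at hi; omega⟩
      rw [Abelian.Ext.eq_zero_of_projective x, smul_zero]
    · rw [ExtVanishesAt, extVanishes_iff]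
      push Not
      refine ⟨Abelian.Ext.mk₀ (ModuleCat.ofHom e.toLinearMap), fun r hr h0 => hr ?_⟩
      have h1 := (Abelian.Ext.mk₀_eq_zero_iff _).1
        ((Abelian.Ext.mk₀_smul r (ModuleCat.ofHom e.toLinearMap)).trans h0)
      have h2 := LinearMap.congr_fun (ModuleCat.hom_ext_iff.1 h1) (e.symm 1)
      have h3 : r = 0 := by simpa using h2
      exact h3 ▸ p.1.zero_mem
  | insert a F ha ih =>
    obtain ⟨h1, h2⟩ := ih ((Finset.subset_insert _ _).trans hF)
    have hreg := hV.mem_iff hF ha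
    rw [Finset.card_insert_of_notMem ha, sup_span_insert]
    refine ⟨fun i hi => ?_, fun h => h2 ?_⟩
    · obtain ⟨i, rfl⟩ : ∃ k, i = k + 1 := ⟨i - 1, by omega⟩
      exact ExtVanishesAt.right hreg (h1 i (by omega)) (h1 (i + 1) (by omega))
    · exact ExtVanishesAt.of_regular hreg (hVp a (hF (Finset.mem_insert_self _ _))) h

/-- If `Y` is a regular sequence on `S/J`, contained in the prime `p` generated by a regular
sequence of length `#Y + m`, and `p` is associated to `S/(J + (Y))`, then `Ext^m(S/J, S)` is not
zero at `p`. -/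
theorem not_extVanishesAt [DecidableEq S] [IsNoetherianRing S] [IsDomain S] {V Y : Finset S} {m : ℕ}
    (hV : IsPermutableRegular ⊥ V) (hVp : Ideal.span (V : Set S) = p.asIdeal)
    (hY : IsPermutableRegular J Y) (hYV : Y ⊆ V) {u : S}
    (hu : ∀ f, f ∈ p.asIdeal ↔ u * f ∈ J ⊔ Ideal.span (Y : Set S))
    (hcard : V.card = Y.card + m) : ¬ ExtVanishesAt p J m := by
  have hmem : ∀ v ∈ V, v ∈ p.asIdeal := fun v hv => hVp ▸ Ideal.subset_span hv
  obtain ⟨h1, h2⟩ := extVanishesAt_span hV hmem V le_rfl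
  rw [bot_sup_eq, hVp] at h1 h2
  have hall := extVanishesAt_of_prime h1
  have top : ¬ ExtVanishesAt p (J ⊔ Ideal.span (Y : Set S)) V.card := fun h =>
    h2 (ExtVanishesAt.left hu h (hall _ _ (by omega)))
  have main : ∀ k, ∀ F : Finset S, F ⊆ Y → F.card + k = Y.card →
      (∀ i, F.card + m < i → ExtVanishesAt p (J ⊔ Ideal.span (F : Set S)) i) ∧
        ¬ ExtVanishesAt p (J ⊔ Ideal.span (F : Set S)) (F.card + m) := by
    intro k
    induction k with
    | zero =>
      intro F hF hk
      obtain rfl := Finset.eq_of_subset_of_card_le hF (by omega)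
      exact ⟨fun i hi => hall _ _ (by omega), hcard ▸ top⟩
    | succ k ih =>
      intro F hF hk
      obtain ⟨a, haY, haF⟩ := Finset.exists_mem_notMem_of_card_lt_card
        (show F.card < Y.card by omega)
      have hins : insert a F ⊆ Y := Finset.insert_subset haY hF
      have hc := Finset.card_insert_of_notMem haF
      obtain ⟨h3, h4⟩ := ih _ hins (by omega)
      rw [hc, sup_span_insert] at h3 h4
      have hreg := hY.mem_iff hins haF
      have hap := hmem a (hYV haY)
      have h5 : ∀ i, F.card + m < i → ExtVanishesAt p (J ⊔ Ideal.span (F : Set S)) i :=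
        fun i hi => ExtVanishesAt.of_regular hreg hap (h3 (i + 1) (by omega))
      refine ⟨h5, fun h => h4 ?_⟩
      rw [add_right_comm]
      exact ExtVanishesAt.right hreg h (h5 _ (by omega))
  simpa using (main Y.card ∅ (by simp) (by simp)).2

end ExtSupport

section OldExt

open CategoryTheory

variable {S : Type} [CommRing S]

lemma exact_of_not_nontrivial_ext {M N : ModuleCat.{0} S} (P : ProjectiveResolution M) {j : ℕ}
    (h : ¬ Nontrivial (((Ext S (ModuleCat S) j).obj (Opposite.op M)).obj N)) {i : ℕ}
    (hi : (ComplexShape.up ℕ).prev j = i) (f : P.complex.X j ⟶ N)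
    (hf : P.complex.d (j + 1) j ≫ f = 0) :
    ∃ g : P.complex.X i ⟶ N, P.complex.d j i ≫ g = f := by
  rw [not_nontrivial_iff_subsingleton] at h
  have h0 := ModuleCat.isZero_of_subsingleton (((Ext S (ModuleCat S) j).obj (Opposite.op M)).obj N)
  have h1 := h0.of_iso (P.isoExt (R := S) j N).symm
  rw [← HomologicalComplex.exactAt_iff_isZero_homology,
    HomologicalComplex.exactAt_iff' _ i j (j + 1) hi (by simp)] at h1
  exact (ShortComplex.ShortExact.moduleCat_exact_iff_function_exact _).1 h1 f |>.1 hf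

lemma nontrivial_ext_of_nontrivial {M N : ModuleCat.{0} S} {j : ℕ}
    [Nontrivial (Abelian.Ext M N (j + 1))] :
    Nontrivial (((Ext S (ModuleCat S) (j + 1)).obj (Opposite.op M)).obj N) := by
  by_contra h
  refine not_subsingleton (Abelian.Ext M N (j + 1)) (subsingleton_of_forall_eq 0 fun x => ?_)
  let P := projectiveResolution M
  obtain ⟨f, hf, rfl⟩ := P.extMk_surjective x (j + 2) rfl
  rw [P.extMk_eq_zero_iff f _ rfl hf j rfl]
  exact exact_of_not_nontrivial_ext P h (by simp) f hf

lemma nontrivial_ext_zero_of_ne_zero {M N : ModuleCat.{0} S} {f : M ⟶ N} (hf : f ≠ 0) :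
    Nontrivial (((Ext S (ModuleCat S) 0).obj (Opposite.op M)).obj N) := by
  by_contra h
  let P := projectiveResolution M
  let π : P.complex.X 0 ⟶ M := P.π.f 0
  have hπ : Epi π := inferInstanceAs (Epi (P.π.f 0))
  have hd : P.complex.d 1 0 ≫ π = 0 := P.complex_d_comp_π_f_zero
  obtain ⟨g, hg⟩ := exact_of_not_nontrivial_ext P h CochainComplex.prev_nat_zero
    (π ≫ f) (by rw [← Category.assoc, hd, Limits.zero_comp])
  rw [P.complex.shape 0 0 (by simp), Limits.zero_comp] at hg
  exact hf (Limits.zero_of_epi_comp π hg.symm)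

/-- Nonvanishing of `Ext^{j+2}(S/J, S)` gives nonvanishing of `Ext^{j+1}(J, S)`. -/
lemma nontrivial_ext_ideal_of_not_extVanishesAt {p : PrimeSpectrum S} {J : Ideal S} {j : ℕ}
    (h : ¬ ExtVanishesAt p J (j + 2)) :
    Nontrivial (((Ext S (ModuleCat S) (j + 1)).obj (Opposite.op (ModuleCat.of S J))).obj
      (ModuleCat.of S S)) := by
  have : Nontrivial (Abelian.Ext (ModuleCat.of S J) (ModuleCat.of S S) (j + 1)) := by
    by_contra h'
    rw [not_nontrivial_iff_subsingleton] at h'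
    refine h ?_
    rw [ExtVanishesAt, extVanishes_iff]
    intro x
    refine ⟨1, p.1.ne_top_iff_one.1 p.2.ne_top, ?_⟩
    rw [one_smul]
    have hw : J.mkQ ∘ₗ J.subtype = 0 :=
      LinearMap.ext fun x => Ideal.Quotient.eq_zero_iff_mem.2 x.2
    have hT : (ModuleCat.shortComplexOfCompEqZero J.subtype J.mkQ hw).ShortExact :=
      ModuleCat.shortComplex_shortExact _
        (LinearMap.exact_subtype_mkQ J) J.injective_subtype J.mkQ_surjective
    have : Projective (ModuleCat.shortComplexOfCompEqZero J.subtype J.mkQ hw).X₂ :=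
      inferInstanceAs (Projective (ModuleCat.of S S))
    obtain ⟨y, hy⟩ := Abelian.Ext.contravariant_sequence_exact₃ hT _ x
      (Abelian.Ext.eq_zero_of_projective _) (add_comm 1 (j + 1))
    rw [← hy, show y = 0 from h'.elim _ _, Abelian.Ext.comp_zero]
  exact nontrivial_ext_of_nontrivial

lemma nontrivial_ext_zero_ideal {J : Ideal S} (h : J ≠ ⊥) :
    Nontrivial (((Ext S (ModuleCat S) 0).obj (Opposite.op (ModuleCat.of S J))).obj
      (ModuleCat.of S S)) := by
  refine nontrivial_ext_zero_of_ne_zero (f := ModuleCat.ofHom J.subtype) fun h0 => h ?_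
  rw [eq_bot_iff]
  intro x hx
  exact LinearMap.congr_fun (ModuleCat.hom_ext_iff.1 h0) ⟨x, hx⟩

end OldExt

section Pfaffian

variable {R : Type*} [CommRing R]

lemma two_mul_val_lt {n : ℕ} (i : Fin n) : 2 * (i : ℕ) < 2 * n := by omega

lemma two_mul_val_add_one_lt {n : ℕ} (i : Fin n) : 2 * (i : ℕ) + 1 < 2 * n := by omega

/-- The sum over permutations defining the Pfaffian, without the normalization by `2^n n!`. -/
def pfaffianSum {n : ℕ} (A : Matrix (Fin (2 * n)) (Fin (2 * n)) R) : R :=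
  ∑ σ : Equiv.Perm (Fin (2 * n)), (Equiv.Perm.sign σ : ℤ) •
    ∏ i : Fin n, A (σ ⟨2 * (i : ℕ), two_mul_val_lt i⟩)
      (σ ⟨2 * (i : ℕ) + 1, two_mul_val_add_one_lt i⟩)

lemma map_pfaffianSum {R' : Type*} [CommRing R'] (f : R →+* R') {n : ℕ}
    (A : Matrix (Fin (2 * n)) (Fin (2 * n)) R) :
    f (pfaffianSum A) = pfaffianSum (A.map f) := by
  simp [pfaffianSum, map_sum, map_prod]

/-- The sub-maximal Pfaffians with alternating signs. -/
def subPfaffian {n : ℕ} (M : Matrix (Fin (2 * n + 1)) (Fin (2 * n + 1)) R)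
    (k : Fin (2 * n + 1)) : R :=
  (-1) ^ (k : ℕ) * pfaffianSum (M.submatrix k.succAbove k.succAbove)

/-- The permutation of `Fin (m + 1)` sending `0` to `j` and acting as `σ` on the rest. -/
def insertZeroPerm {m : ℕ} (j : Fin (m + 1)) (σ : Equiv.Perm (Fin m)) :
    Equiv.Perm (Fin (m + 1)) :=
  j.cycleRange⁻¹ * Equiv.Perm.decomposeFin.symm (0, σ)

lemma insertZeroPerm_zero {m : ℕ} (j : Fin (m + 1)) (σ : Equiv.Perm (Fin m)) :
    insertZeroPerm j σ 0 = j := by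
  simp [insertZeroPerm]

lemma insertZeroPerm_succ {m : ℕ} (j : Fin (m + 1)) (σ : Equiv.Perm (Fin m)) (i : Fin m) :
    insertZeroPerm j σ i.succ = j.succAbove (σ i) := by
  simp [insertZeroPerm]

lemma sign_insertZeroPerm {m : ℕ} (j : Fin (m + 1)) (σ : Equiv.Perm (Fin m)) :
    Equiv.Perm.sign (insertZeroPerm j σ) = (-1) ^ (j : ℕ) * Equiv.Perm.sign σ := by
  simp [insertZeroPerm]

lemma insertZeroPerm_bijective (m : ℕ) : Function.Bijective
    fun q : Fin (m + 1) × Equiv.Perm (Fin m) => insertZeroPerm q.1 q.2 := by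
  rw [Fintype.bijective_iff_injective_and_card]
  constructor
  · rintro ⟨j, σ⟩ ⟨j', σ'⟩ h
    have h' : insertZeroPerm j σ = insertZeroPerm j' σ' := h
    obtain rfl : j = j' := by rw [← insertZeroPerm_zero j σ, h', insertZeroPerm_zero]
    congr 1
    ext1 i
    apply j.succAbove_right_injective
    rw [← insertZeroPerm_succ, ← insertZeroPerm_succ, h']
  · simp [Fintype.card_perm, Nat.factorial_succ]

/-- The position paired with `a` when `{1, ..., 2n}` is divided into consecutive pairs. -/
def partner {n : ℕ} (a : Fin (2 * n + 1)) : Fin (2 * n + 1) :=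
  if h : (a : ℕ) % 2 = 1 then ⟨a + 1, by omega⟩ else ⟨a - 1, by omega⟩

lemma sum_perm_eq_zero {n : ℕ} (M : Matrix (Fin (2 * n + 1)) (Fin (2 * n + 1)) R)
    (hM : ∀ i j, M j i = -M i j) (hM0 : ∀ i, M i i = 0) (i : Fin (2 * n + 1)) :
    ∑ τ : Equiv.Perm (Fin (2 * n + 1)), (Equiv.Perm.sign τ : ℤ) • (M i (τ 0) *
      ∏ m : Fin n, M (τ ⟨2 * (m : ℕ) + 1, by omega⟩) (τ ⟨2 * (m : ℕ) + 2, by omega⟩)) = 0 := by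
  classical
  have h0 : ∀ τ : Equiv.Perm (Fin (2 * n + 1)), τ.symm i = 0 → M i (τ 0) = 0 := by
    intro τ h
    rw [← h, Equiv.apply_symm_apply, hM0]
  have hne : ∀ a : Fin (2 * n + 1), a ≠ 0 → partner a ≠ 0 ∧ partner a ≠ a := by
    intro a ha
    have ha' : (a : ℕ) ≠ 0 := fun h => ha (Fin.ext h)
    unfold partner
    split_ifs with h
    · refine ⟨fun h' => ?_, fun h' => ?_⟩
      · have : (a : ℕ) + 1 = 0 := congrArg Fin.val h'
        omega
      · have : (a : ℕ) + 1 = a := congrArg Fin.val h'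
        omega
    · refine ⟨fun h' => ?_, fun h' => ?_⟩
      · have : (a : ℕ) - 1 = 0 := congrArg Fin.val h'
        omega
      · have : (a : ℕ) - 1 = a := congrArg Fin.val h'
        omega
  refine Finset.sum_ninvolution
    (fun τ => if τ.symm i = 0 then τ else τ * Equiv.swap 0 (partner (τ.symm i))) ?_ ?_ ?_ ?_
  · intro τ
    by_cases ha : τ.symm i = 0
    · rw [if_pos ha, h0 τ ha, zero_mul, smul_zero, add_zero]
    rw [if_neg ha]
    obtain ⟨a, rfl⟩ := τ.surjective i
    rw [Equiv.symm_apply_apply] at ha ⊢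
    obtain ⟨h1, h2⟩ := hne a ha
    rw [Equiv.Perm.sign_mul, Equiv.Perm.sign_swap h1.symm]
    have ha' : (a : ℕ) ≠ 0 := fun h => ha (Fin.ext h)
    let m₀ : Fin n := ⟨(a - 1) / 2, by omega⟩
    rw [← Finset.mul_prod_erase _ _ (Finset.mem_univ m₀),
      ← Finset.mul_prod_erase _ _ (Finset.mem_univ m₀)]
    have hprod : ∀ m ∈ Finset.univ.erase m₀,
        M ((τ * Equiv.swap 0 (partner a)) ⟨2 * (m : ℕ) + 1, by omega⟩)
          ((τ * Equiv.swap 0 (partner a)) ⟨2 * (m : ℕ) + 2, by omega⟩) =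
        M (τ ⟨2 * (m : ℕ) + 1, by omega⟩) (τ ⟨2 * (m : ℕ) + 2, by omega⟩) := by
      intro m hm
      have hm' : (m : ℕ) ≠ (a - 1) / 2 := fun h => (Finset.ne_of_mem_erase hm) (Fin.ext h)
      rw [Equiv.Perm.mul_apply, Equiv.Perm.mul_apply, Equiv.swap_apply_of_ne_of_ne,
        Equiv.swap_apply_of_ne_of_ne]
      all_goals try unfold partner
      all_goals try split_ifs
      all_goals simp [Fin.ext_iff]
      all_goals omega
    rw [Finset.prod_congr rfl hprod]
    have key : M (τ a) (τ 0) * M (τ ⟨2 * (m₀ : ℕ) + 1, by omega⟩) (τ ⟨2 * (m₀ : ℕ) + 2, by omega⟩)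
        = M (τ a) ((τ * Equiv.swap 0 (partner a)) 0) *
          M ((τ * Equiv.swap 0 (partner a)) ⟨2 * (m₀ : ℕ) + 1, by omega⟩)
          ((τ * Equiv.swap 0 (partner a)) ⟨2 * (m₀ : ℕ) + 2, by omega⟩) := by
      have hsa : Equiv.swap 0 (partner a) a = a :=
        Equiv.swap_apply_of_ne_of_ne ha h2.symm
      by_cases hodd : (a : ℕ) % 2 = 1
      · have e1 : (⟨2 * (m₀ : ℕ) + 1, by omega⟩ : Fin (2 * n + 1)) = a :=
          Fin.ext (by change 2 * ((a - 1) / 2) + 1 = (a : ℕ); omega)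
        have e2 : (⟨2 * (m₀ : ℕ) + 2, by omega⟩ : Fin (2 * n + 1)) = partner a :=
          Fin.ext (by
            unfold partner
            rw [dif_pos hodd]
            change 2 * ((a - 1) / 2) + 2 = (a : ℕ) + 1; omega)
        rw [e1, e2]
        simp only [Equiv.Perm.mul_apply, hsa, Equiv.swap_apply_left, Equiv.swap_apply_right]
        ring
      · have e1 : (⟨2 * (m₀ : ℕ) + 2, by omega⟩ : Fin (2 * n + 1)) = a :=
          Fin.ext (by change 2 * ((a - 1) / 2) + 2 = (a : ℕ); omega)
        have e2 : (⟨2 * (m₀ : ℕ) + 1, by omega⟩ : Fin (2 * n + 1)) = partner a :=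
          Fin.ext (by
            unfold partner
            rw [dif_neg hodd]
            change 2 * ((a - 1) / 2) + 1 = (a : ℕ) - 1; omega)
        rw [e1, e2]
        simp only [Equiv.Perm.mul_apply, hsa, Equiv.swap_apply_left, Equiv.swap_apply_right]
        rw [hM (τ a) (τ 0), hM (τ a) (τ (partner a))]
        ring
    rw [← mul_assoc, ← mul_assoc, key]
    simp
  · intro τ hτ
    have ha : τ.symm i ≠ 0 := fun h => hτ (by rw [h0 τ h]; simp)
    rw [if_neg ha]
    intro h
    have := (hne _ ha).1
    rw [mul_eq_left] at h
    have h3 := Equiv.swap_apply_left (0 : Fin (2 * n + 1)) (partner (τ.symm i))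
    rw [h] at h3
    exact this h3.symm
  · simp
  · intro τ
    by_cases ha : τ.symm i = 0
    · simp [ha]
    · rw [if_neg ha]
      obtain ⟨h1, h2⟩ := hne _ ha
      have : (τ * Equiv.swap 0 (partner (τ.symm i))).symm i = τ.symm i := by
        rw [Equiv.symm_apply_eq, Equiv.Perm.mul_apply,
          Equiv.swap_apply_of_ne_of_ne ha h2.symm, Equiv.apply_symm_apply]
      rw [this, if_neg ha, mul_assoc, Equiv.swap_mul_self, mul_one]

/-- A skew-symmetric matrix annihilates the vector of its signed sub-maximal Pfaffians. -/
lemma sum_mul_subPfaffian {n : ℕ} (M : Matrix (Fin (2 * n + 1)) (Fin (2 * n + 1)) R)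
    (hM : ∀ i j, M j i = -M i j) (hM0 : ∀ i, M i i = 0) (i : Fin (2 * n + 1)) :
    ∑ j, M i j * subPfaffian M j = 0 := by
  rw [← sum_perm_eq_zero M hM hM0 i,
    ← (insertZeroPerm_bijective (2 * n)).sum_comp, Fintype.sum_prod_type]
  refine Finset.sum_congr rfl fun j _ => ?_
  rw [subPfaffian, pfaffianSum, Finset.mul_sum, Finset.mul_sum]
  refine Finset.sum_congr rfl fun σ _ => ?_
  rw [insertZeroPerm_zero, sign_insertZeroPerm]
  have e1 : ∀ m : Fin n, insertZeroPerm j σ ⟨2 * (m : ℕ) + 1, by omega⟩ =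
      j.succAbove (σ ⟨2 * (m : ℕ), two_mul_val_lt m⟩) := fun m =>
    insertZeroPerm_succ j σ ⟨2 * (m : ℕ), two_mul_val_lt m⟩
  have e2 : ∀ m : Fin n, insertZeroPerm j σ ⟨2 * (m : ℕ) + 2, by omega⟩ =
      j.succAbove (σ ⟨2 * (m : ℕ) + 1, two_mul_val_add_one_lt m⟩) := fun m =>
    insertZeroPerm_succ j σ ⟨2 * (m : ℕ) + 1, two_mul_val_add_one_lt m⟩
  simp only [e1, e2, Matrix.submatrix_apply, zsmul_eq_mul]
  push_cast
  ring

end Pfaffian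

section PairPermutation

variable {n : ℕ}

lemma sign_mul_prod_eq_one (σ : Equiv.Perm (Fin n × Fin 2))
    (h : ∀ i, (σ (i, 0)).1 = (σ (i, 1)).1) :
    (Equiv.Perm.sign σ : ℤ) * ∏ i, (((σ (i, 1)).2 : ℤ) - (σ (i, 0)).2) = 1 := by
  have h' : ∀ i a, (σ (i, a)).1 = (σ (i, 0)).1 := by
    intro i a
    fin_cases a
    · rfl
    · exact (h i).symm
  have hsurj : Function.Surjective fun i => (σ (i, 0)).1 := by
    intro m
    obtain ⟨⟨i, a⟩, hi⟩ := σ.surjective (m, 0)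
    exact ⟨i, by simp only; rw [← h' i a, hi]⟩
  let ρ : Equiv.Perm (Fin n) := Equiv.ofBijective _ hsurj.bijective_of_finite
  have hinj : ∀ i, Function.Injective fun a => (σ (i, a)).2 := by
    intro i a b hab
    have : σ (i, a) = σ (i, b) := Prod.ext ((h' i a).trans (h' i b).symm) hab
    exact (Prod.ext_iff.1 (σ.injective this)).2
  let t : Fin n → Equiv.Perm (Fin 2) := fun i =>
    Equiv.ofBijective _ (hinj i).bijective_of_finite
  have hσ : σ = (Equiv.prodCongrLeft fun _ => ρ : Equiv.Perm (Fin n × Fin 2)) *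
      Equiv.prodCongrRight t := by
    ext1 ⟨i, a⟩
    exact Prod.ext (h' i a) rfl
  have ht : ∀ u : Equiv.Perm (Fin 2), ((u 1 : ℕ) : ℤ) - (u 0 : ℕ) = Equiv.Perm.sign u := by
    decide
  have hprod : ∏ i, (((σ (i, 1)).2 : ℤ) - (σ (i, 0)).2) =
      ∏ i, ((Equiv.Perm.sign (t i) : ℤˣ) : ℤ) :=
    Finset.prod_congr rfl fun i _ => ht (t i)
  rw [hprod]
  conv_lhs => rw [hσ]
  rw [Equiv.Perm.sign_mul, Equiv.Perm.sign_prodCongrLeft, Equiv.Perm.sign_prodCongrRight,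
    ← Units.coe_prod, ← Units.val_mul, Fin.prod_univ_two, Int.units_mul_self, one_mul,
    Int.units_mul_self, Units.val_one]

/-- The decomposition of `{0, ..., 2n - 1}` into consecutive pairs. -/
def pairEquiv (n : ℕ) : Fin n × Fin 2 ≃ Fin (2 * n) where
  toFun p := ⟨2 * p.1 + p.2, by omega⟩
  invFun x := (⟨x / 2, by omega⟩, ⟨x % 2, by omega⟩)
  left_inv := by
    rintro ⟨i, a⟩
    refine Prod.ext (Fin.ext ?_) (Fin.ext ?_)
    · change (2 * (i : ℕ) + a) / 2 = i
      omega
    · change (2 * (i : ℕ) + a) % 2 = a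
      omega
  right_inv x := Fin.ext (Nat.div_add_mod _ _)

/-- The unnormalized Pfaffian of the standard symplectic matrix does not vanish. -/
lemma pfaffianSum_ne_zero {K : Type*} [Field K] [CharZero K]
    (B : Matrix (Fin (2 * n)) (Fin (2 * n)) K)
    (hB : ∀ p q, B (pairEquiv n p) (pairEquiv n q) =
      if p.1 = q.1 then (((q.2 : ℤ) - p.2 : ℤ) : K) else 0) : pfaffianSum B ≠ 0 := by
  classical
  have hterm : pfaffianSum B = ∑ σ : Equiv.Perm (Fin n × Fin 2),
      if ∀ i, (σ (i, 0)).1 = (σ (i, 1)).1 then 1 else 0 := by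
    rw [pfaffianSum]
    refine (Fintype.sum_equiv (pairEquiv n).permCongr _ _ fun σ => ?_).symm
    have e0 : ∀ i : Fin n, (pairEquiv n).permCongr σ ⟨2 * (i : ℕ), two_mul_val_lt i⟩ =
        pairEquiv n (σ (i, 0)) := fun i =>
      congrArg (fun x => pairEquiv n (σ x)) ((pairEquiv n).symm_apply_apply (i, 0))
    have e1 : ∀ i : Fin n, (pairEquiv n).permCongr σ ⟨2 * (i : ℕ) + 1, two_mul_val_add_one_lt i⟩ =
        pairEquiv n (σ (i, 1)) := fun i =>
      congrArg (fun x => pairEquiv n (σ x)) ((pairEquiv n).symm_apply_apply (i, 1))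
    simp only [e0, e1, hB, Equiv.Perm.sign_permCongr]
    split_ifs with h
    · rw [Finset.prod_congr rfl fun i _ => if_pos (h i), zsmul_eq_mul, ← Int.cast_prod,
        ← Int.cast_mul, sign_mul_prod_eq_one σ h, Int.cast_one]
    · push Not at h
      obtain ⟨i, hi⟩ := h
      rw [Finset.prod_eq_zero (Finset.mem_univ i) (if_neg hi), smul_zero]
  rw [hterm, Finset.sum_boole]
  refine Nat.cast_ne_zero.2 (Finset.card_ne_zero.2 ⟨1, ?_⟩)
  simp

end PairPermutation

section Toric

variable {n : ℕ}

lemma exists_start_of_card_le (M : Finset (ZMod (2 * n + 1))) (hM : M.Nonempty)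
    (hcard : M.card ≤ n) : ∃ k ∈ M, k - 1 ∉ M ∧ k + n ∉ M := by
  classical
  have hN : ((n : ZMod (2 * n + 1)) + n + 1) = 0 := by
    have := ZMod.natCast_self (2 * n + 1)
    push_cast at this
    rw [← this]; ring
  obtain ⟨p, hp⟩ : ∃ p, p ∉ M ∪ M.image (fun k => k - (n : ZMod (2 * n + 1))) := by
    by_contra! h
    have h1 : (Finset.univ : Finset (ZMod (2 * n + 1))).card ≤ n + n :=
      (Finset.card_le_card fun x _ => h x).trans ((Finset.card_union_le _ _).trans
        (add_le_add hcard (Finset.card_image_le.trans hcard)))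
    rw [Finset.card_univ, ZMod.card] at h1
    omega
  rw [Finset.mem_union, not_or] at hp
  have hp2 : p + n ∉ M := fun h => hp.2 (Finset.mem_image.2 ⟨_, h, by ring⟩)
  by_contra! hcon
  have key : ∀ j : ℕ, p + j ∉ M ∧ p + n + j ∉ M := by
    intro j
    induction j with
    | zero => simpa using ⟨hp.1, hp2⟩
    | succ j ih =>
      have h1 : p + n + (j + 1 : ℕ) ∉ M := by
        intro h
        refine ih.1 ?_
        have h2 := hcon _ h (by
          convert ih.2 using 1; push_cast; ring_nf)
        convert h2 using 1; push_cast; linear_combination -hN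
      refine ⟨fun h => h1 ?_, h1⟩
      have h2 := hcon _ h (by convert ih.1 using 1; push_cast; ring_nf)
      convert h2 using 1; ring
  obtain ⟨k, hk⟩ := hM
  refine (key (k - p).val).1 ?_
  rwa [ZMod.natCast_zmod_val, add_sub_cancel]

lemma exists_median (f : ZMod (2 * n + 1) → ℤ) :
    ∃ c : ℤ, (Finset.univ.filter fun k => c < f k).card ≤ n ∧
      (Finset.univ.filter fun k => f k < c).card ≤ n := by
  have habs : ∀ k, |f k| ≤ ∑ k, |f k| := fun k =>
    Finset.single_le_sum (f := fun k => |f k|) (fun k _ => abs_nonneg (f k)) (Finset.mem_univ k)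
  have hcardU : (Finset.univ : Finset (ZMod (2 * n + 1))).card = 2 * n + 1 := by
    rw [Finset.card_univ, ZMod.card]
  obtain ⟨c, hc, hmin⟩ := Int.exists_least_of_bdd
    (P := fun c => (Finset.univ.filter fun k => c < f k).card ≤ n)
    ⟨-∑ k, |f k|, fun c hc => by
      by_contra! h
      rw [Finset.filter_true_of_mem, hcardU] at hc
      · omega
      · intro k _
        linarith [neg_abs_le (f k), habs k]⟩
    ⟨∑ k, |f k|, by
      rw [Finset.filter_false_of_mem]
      · simp
      · intro k _
        linarith [le_abs_self (f k), habs k]⟩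
  refine ⟨c, hc, ?_⟩
  by_contra! h
  have h1 : (Finset.univ.filter fun k => c - 1 < f k).card ≤ n := by
    have := Finset.card_filter_add_card_filter_not (s := Finset.univ) (fun k => f k < c)
    rw [hcardU] at this
    have h2 : (Finset.univ.filter fun k => c - 1 < f k) =
        Finset.univ.filter fun k => ¬ f k < c := by
      ext k; simp only [Finset.mem_filter]; constructor <;> rintro ⟨h, h'⟩ <;>
        exact ⟨h, by omega⟩
    rw [h2]; omega
  have := hmin _ h1
  omega

lemma exists_sub_shift_eq (h : ZMod (2 * n + 1) → ℤ) (hsum : ∑ k, h k = 0) :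
    ∃ f : ZMod (2 * n + 1) → ℤ, ∀ k, f k - f (k - 1) = h k := by
  let F : ℕ → ℤ := fun j => ∑ i ∈ Finset.range j, h i
  have hper : Function.Periodic F (2 * n + 1) := by
    intro j
    have h1 : ∑ i ∈ Finset.range (2 * n + 1), h ((j + i : ℕ) : ZMod (2 * n + 1)) = 0 := by
      rw [← hsum, ← Fin.sum_univ_eq_sum_range (fun i => h ((j + i : ℕ) : ZMod (2 * n + 1)))]
      refine Fintype.sum_equiv (Equiv.addLeft (j : ZMod (2 * n + 1))) _ _ fun i => ?_
      congr 1
      rw [Equiv.coe_addLeft, Nat.cast_add]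
      congr 1
      exact ZMod.natCast_zmod_val (n := 2 * n + 1) i
    simp only [F]
    rw [Finset.sum_range_add, h1, add_zero]
  have hF : ∀ j : ℕ, F ((j : ZMod (2 * n + 1)).val) = F j := by
    intro j
    rw [ZMod.val_natCast, hper.map_mod_nat]
  refine ⟨fun k => F (k + 1).val, fun k => ?_⟩
  have e1 : k + 1 = ((k.val + 1 : ℕ) : ZMod (2 * n + 1)) := by simp
  have e2 : k - 1 + 1 = ((k.val : ℕ) : ZMod (2 * n + 1)) := by simp
  simp only
  rw [e1, e2, hF, hF]
  simp [F, Finset.sum_range_succ]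

variable (K : Type*) [Field K]

/-- The toric relation `w_k T_k - w_{k-n} T_{k+1}`. -/
noncomputable def toricRelation (k : ZMod (2 * n + 1)) :
    MvPolynomial (ZMod (2 * n + 1) ⊕ ZMod (2 * n + 1)) K :=
  X (Sum.inl k) * X (Sum.inr k) - X (Sum.inl (k - n)) * X (Sum.inr (k + 1))

variable {K}

lemma monomial_sub_monomial_mem_of_potential
    (J : Ideal (MvPolynomial (ZMod (2 * n + 1) ⊕ ZMod (2 * n + 1)) K))
    (hJ : ∀ k, toricRelation K k ∈ J) (B : ℕ) :
    ∀ (f : ZMod (2 * n + 1) → ℤ) (m m' : ZMod (2 * n + 1) ⊕ ZMod (2 * n + 1) →₀ ℕ),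
      ∑ k, |f k| ≤ B → (Finset.univ.filter fun k => 0 < f k).card ≤ n →
      (Finset.univ.filter fun k => f k < 0).card ≤ n →
      (∀ k, (m (Sum.inr k) : ℤ) - m' (Sum.inr k) = f k - f (k - 1)) →
      (∀ k, (m' (Sum.inl k) : ℤ) - m (Sum.inl k) = f (k + n) - f k) →
      monomial m (1 : K) - monomial m' 1 ∈ J := by
  classical
  induction B with
  | zero =>
    intro f m m' hB _ _ hr hl
    have h0 : ∀ k, f k = 0 := by
      intro k
      have := (Finset.sum_eq_zero_iff_of_nonneg (fun k _ => abs_nonneg (f k))).1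
        (le_antisymm (by exact_mod_cast hB) (Finset.sum_nonneg fun k _ => abs_nonneg (f k)))
        k (Finset.mem_univ k)
      exact abs_eq_zero.1 this
    have : m = m' := by
      ext x
      rcases x with k | k
      · have := hl k; rw [h0, h0] at this; omega
      · have := hr k; rw [h0, h0] at this; omega
    rw [this, sub_self]
    exact J.zero_mem
  | succ B ih =>
    have main : ∀ (f : ZMod (2 * n + 1) → ℤ)
        (m m' : ZMod (2 * n + 1) ⊕ ZMod (2 * n + 1) →₀ ℕ),
        ∑ k, |f k| ≤ (B + 1 : ℕ) → (Finset.univ.filter fun k => 0 < f k).card ≤ n →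
        (Finset.univ.filter fun k => f k < 0).card ≤ n →
        (∀ k, (m (Sum.inr k) : ℤ) - m' (Sum.inr k) = f k - f (k - 1)) →
        (∀ k, (m' (Sum.inl k) : ℤ) - m (Sum.inl k) = f (k + n) - f k) →
        (∃ k, 0 < f k) → monomial m (1 : K) - monomial m' 1 ∈ J := by
      intro f m m' hB hp hneg hr hl ⟨k₀, hk₀⟩
      obtain ⟨q, -, hq⟩ := Finset.exists_max_image Finset.univ f ⟨k₀, Finset.mem_univ _⟩
      have hqpos : 0 < f q := hk₀.trans_le (hq k₀ (Finset.mem_univ _))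
      obtain ⟨k, hk, hk1, hkn⟩ := exists_start_of_card_le (Finset.univ.filter fun k => f k = f q)
        ⟨q, by simp⟩ (le_trans (Finset.card_le_card fun x hx => by
          simp only [Finset.mem_filter, Finset.mem_univ, true_and] at hx ⊢; omega) hp)
      simp only [Finset.mem_filter, Finset.mem_univ, true_and] at hk hk1 hkn
      have hk1' : f (k - 1) < f k := by
        rw [hk]; exact lt_of_le_of_ne (hq _ (Finset.mem_univ _)) hk1
      have hkn' : f (k + n) < f k := by
        rw [hk]; exact lt_of_le_of_ne (hq _ (Finset.mem_univ _)) hkn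
      have hmr : 1 ≤ m (Sum.inr k) := by have := hr k; omega
      have hml : 1 ≤ m (Sum.inl k) := by have := hl k; omega
      obtain ⟨m₀, rfl⟩ : ∃ m₀, m = m₀ + (Finsupp.single (Sum.inl k) 1 +
          Finsupp.single (Sum.inr k) 1) := by
        refine ⟨m - (Finsupp.single (Sum.inl k) 1 + Finsupp.single (Sum.inr k) 1),
          (tsub_add_cancel_of_le ?_).symm⟩
        intro x
        rcases x with j | j
        · by_cases h : k = j
          · subst h; simpa using hml
          · simp [h]
        · by_cases h : k = j
          · subst h; simpa using hmr
          · simp [h]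
      let m₁ := m₀ + (Finsupp.single (Sum.inl (k - (n : ZMod (2 * n + 1)))) 1 +
          Finsupp.single (Sum.inr (k + 1)) 1)
      have hstep : monomial (m₀ + (Finsupp.single (Sum.inl k) 1 +
          Finsupp.single (Sum.inr k) 1)) (1 : K) - monomial m₁ 1 ∈ J := by
        have := J.mul_mem_left (monomial m₀ (1 : K)) (hJ k)
        convert this using 1
        simp only [toricRelation, X, mul_sub, monomial_mul, one_mul, m₁]
      have hrec : monomial m₁ (1 : K) - monomial m' 1 ∈ J := by
        refine ih (fun j => f j - if j = k then 1 else 0) m₁ m' ?_ ?_ ?_ ?_ ?_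
        · have h1 : ∑ j, |f j - if j = k then 1 else 0| =
            ∑ j, (|f j| - if j = k then 1 else 0) := by
            refine Finset.sum_congr rfl fun j _ => ?_
            split_ifs with h
            · subst h
              rw [abs_of_pos (show 0 < f j by omega), abs_of_nonneg (by omega)]
            · simp
          rw [h1, Finset.sum_sub_distrib]
          simp only [Finset.sum_ite_eq', Finset.mem_univ, if_true]
          push_cast at hB
          linarith
        · refine le_trans (Finset.card_le_card fun x hx => ?_) hp
          simp only [Finset.mem_filter, Finset.mem_univ, true_and] at hx ⊢
          split_ifs at hx <;> omega
        · refine le_trans (Finset.card_le_card fun x hx => ?_) hneg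
          simp only [Finset.mem_filter, Finset.mem_univ, true_and] at hx ⊢
          split_ifs at hx with h
          · subst h; omega
          · omega
        · intro j
          have := hr j
          simp only [Finsupp.add_apply, Finsupp.single_apply, m₁, Sum.inr.injEq, reduceCtorEq,
            if_false, sub_eq_iff_eq_add, eq_comm (a := j)] at this ⊢
          push_cast at this ⊢
          simp only [← sub_eq_iff_eq_add, eq_comm (b := j)] at this ⊢
          split_ifs at this ⊢ <;> omega
        · intro j
          have := hl j
          have e : (j + (n : ZMod (2 * n + 1)) = k) = (k - (n : ZMod (2 * n + 1)) = j) :=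
            propext ⟨fun h => by rw [← h]; ring, fun h => by rw [← h]; ring⟩
          simp only [Finsupp.add_apply, Finsupp.single_apply, m₁, Sum.inl.injEq, reduceCtorEq,
            if_false, e, eq_comm (a := j)] at this ⊢
          push_cast at this ⊢
          split_ifs at this ⊢ <;> omega
      have := J.add_mem hstep hrec
      rwa [sub_add_sub_cancel] at this
    intro f m m' hB hp hneg hr hl
    by_cases h1 : ∃ k, 0 < f k
    · exact main f m m' hB hp hneg hr hl h1
    by_cases h2 : ∃ k, f k < 0
    · rw [← neg_sub]
      refine J.neg_mem (main (fun k => -f k) m' m ?_ ?_ ?_ ?_ ?_ ?_)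
      · simpa using hB
      · simpa using hneg
      · simpa using hp
      · intro k; have := hr k; omega
      · intro k; have := hl k; omega
      · obtain ⟨k, hk⟩ := h2; exact ⟨k, by simpa using hk⟩
    push Not at h1 h2
    have h0 : ∀ k, f k = 0 := fun k => le_antisymm (h1 k) (h2 k)
    refine ih f m m' ?_ hp hneg hr hl
    simp [h0]

lemma monomial_sub_monomial_mem
    (J : Ideal (MvPolynomial (ZMod (2 * n + 1) ⊕ ZMod (2 * n + 1)) K))
    (hJ : ∀ k, toricRelation K k ∈ J)
    (m m' : ZMod (2 * n + 1) ⊕ ZMod (2 * n + 1) →₀ ℕ)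
    (hr : ∑ k, m (Sum.inr k) = ∑ k, m' (Sum.inr k))
    (hl : ∀ k, m (Sum.inl k) + ∑ i ∈ Finset.range n, m (Sum.inr (k + (i + 1 : ℕ))) =
      m' (Sum.inl k) + ∑ i ∈ Finset.range n, m' (Sum.inr (k + (i + 1 : ℕ)))) :
    monomial m (1 : K) - monomial m' 1 ∈ J := by
  obtain ⟨f, hf⟩ := exists_sub_shift_eq
    (fun k => (m (Sum.inr k) : ℤ) - m' (Sum.inr k)) (by
      rw [Finset.sum_sub_distrib, sub_eq_zero]; exact_mod_cast hr)
  obtain ⟨c, hc1, hc2⟩ := exists_median f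
  refine monomial_sub_monomial_mem_of_potential J hJ (∑ k, |f k - c|).toNat
    (fun k => f k - c) m m' ?_ ?_ ?_ ?_ ?_
  · exact Int.self_le_toNat _
  · simpa using hc1
  · simpa using hc2
  · intro k; rw [← hf k]; ring
  · intro k
    have h1 : f (k + n) - f k = ∑ i ∈ Finset.range n,
        (f (k + (i + 1 : ℕ)) - f (k + (i : ℕ))) := by
      rw [Finset.sum_range_sub (fun i => f (k + (i : ℕ)))]
      simp
    have h2 : ∀ i : ℕ, f (k + (i + 1 : ℕ)) - f (k + (i : ℕ)) =
        (m (Sum.inr (k + (i + 1 : ℕ))) : ℤ) - m' (Sum.inr (k + (i + 1 : ℕ))) := by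
      intro i
      rw [← hf]
      congr 2
      push_cast; ring
    rw [sub_sub_sub_cancel_right, h1, Finset.sum_congr rfl fun i _ => h2 i, Finset.sum_sub_distrib]
    have := hl k
    zify at this
    push_cast at this ⊢
    linarith

end Toric

section ToricMap

variable {n : ℕ} (K : Type*) [Field K]

/-- The product of the variables in the window of length `n` preceding `k`. -/
noncomputable def window (k : ZMod (2 * n + 1)) : MvPolynomial (ZMod (2 * n + 1)) K :=
  ∏ i ∈ Finset.range n, X (k - (i + 1 : ℕ))

/-- The map `w_k ↦ w_k`, `T_k ↦ g_k t`, where `g_k` is the `k`-th window. -/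
noncomputable def toricMap (n : ℕ) : MvPolynomial (ZMod (2 * n + 1) ⊕ ZMod (2 * n + 1)) K →ₐ[K]
    Polynomial (MvPolynomial (ZMod (2 * n + 1)) K) :=
  aeval (Sum.elim (fun k => Polynomial.C (X k))
    (fun k => Polynomial.C (window K k) * Polynomial.X))

variable {K}

/-- The exponent of the image of a monomial under `toricMap`. -/
noncomputable def toricExponent (m : ZMod (2 * n + 1) ⊕ ZMod (2 * n + 1) →₀ ℕ) :
    ℕ × (ZMod (2 * n + 1) →₀ ℕ) :=
  (∑ k, m (Sum.inr k), Finsupp.equivFunOnFinite.symm fun j =>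
    m (Sum.inl j) + ∑ i ∈ Finset.range n, m (Sum.inr (j + (i + 1 : ℕ))))

lemma toricMap_monomial (m : ZMod (2 * n + 1) ⊕ ZMod (2 * n + 1) →₀ ℕ) (a : K) :
    toricMap K n (monomial m a) =
      Polynomial.monomial (toricExponent m).1 (monomial (toricExponent m).2 a) := by
  have hprod : ∏ k, window K k ^ m (Sum.inr k) =
      ∏ j, (X j : MvPolynomial (ZMod (2 * n + 1)) K) ^
        ∑ i ∈ Finset.range n, m (Sum.inr (j + (i + 1 : ℕ))) := by
    simp_rw [window, ← Finset.prod_pow]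
    rw [Finset.prod_comm]
    simp_rw [← Finset.prod_pow_eq_pow_sum]
    rw [Finset.prod_comm (s := Finset.univ)]
    refine Finset.prod_congr rfl fun i _ => ?_
    refine Fintype.prod_equiv (Equiv.subRight ((i + 1 : ℕ) : ZMod (2 * n + 1))) _ _ fun k => ?_
    simp
  have hmon : ∀ e : ZMod (2 * n + 1) → ℕ,
      (monomial (Finsupp.equivFunOnFinite.symm e) a : MvPolynomial (ZMod (2 * n + 1)) K) =
        C a * ∏ j, X j ^ e j := by
    intro e
    rw [monomial_eq, Finsupp.prod_fintype _ _ (by simp)]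
    rfl
  rw [toricExponent, hmon, toricMap, aeval_monomial, Finsupp.prod_fintype _ _ (by simp),
    Fintype.prod_sum_type]
  simp only [Sum.elim_inl, Sum.elim_inr, mul_pow, Finset.prod_mul_distrib, pow_add,
    ← Polynomial.C_pow, ← map_prod, hprod, Finset.prod_pow_eq_pow_sum]
  rw [← Polynomial.C_mul_X_pow_eq_monomial, ← mul_assoc, ← mul_assoc]
  simp only [map_mul, ← mul_assoc]
  rfl

lemma mem_of_toricMap_eq_zero
    (J : Ideal (MvPolynomial (ZMod (2 * n + 1) ⊕ ZMod (2 * n + 1)) K))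
    (hJ : ∀ k, toricRelation K k ∈ J)
    (c : MvPolynomial (ZMod (2 * n + 1) ⊕ ZMod (2 * n + 1)) K) (hc : toricMap K n c = 0) :
    c ∈ J := by
  classical
  let θ := toricExponent (n := n)
  have hfib : ∀ m m', θ m = θ m' → ∀ a : K, monomial m a - monomial m' a ∈ J := by
    intro m m' h a
    have := J.mul_mem_left (C a) (monomial_sub_monomial_mem J hJ m m' (congrArg Prod.fst h)
      fun k => DFunLike.congr_fun (congrArg Prod.snd h) k)
    rwa [mul_sub, C_mul_monomial, C_mul_monomial, mul_one] at this
  have hcoeff : ∀ g, ∑ m ∈ c.support with θ m = g, coeff m c = 0 := by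
    intro g
    have h1 : ((toricMap K n c).coeff g.1).coeff g.2 = 0 := by simp [hc]
    rw [c.as_sum, map_sum, Polynomial.finsetSum_coeff, coeff_sum] at h1
    rw [← h1, Finset.sum_filter]
    refine Finset.sum_congr rfl fun m _ => ?_
    rw [toricMap_monomial, Polynomial.coeff_monomial]
    by_cases h : θ m = g
    · subst h
      simp [θ]
    · rw [if_neg h]
      split_ifs with h2
      · rw [coeff_monomial, if_neg fun h3 => h (Prod.ext h2 h3)]
      · simp
  have hr : ∀ m, θ (Function.invFun θ (θ m)) = θ m := fun m => Function.invFun_eq ⟨m, rfl⟩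
  have hzero : ∑ m ∈ c.support, monomial (Function.invFun θ (θ m)) (coeff m c) = 0 := by
    rw [← Finset.sum_fiberwise_of_maps_to (t := c.support.image θ)
      fun m hm => Finset.mem_image_of_mem _ hm]
    refine Finset.sum_eq_zero fun g _ => ?_
    rw [Finset.sum_congr rfl (g := fun m => monomial (Function.invFun θ g) (coeff m c))
      fun m hm => by rw [(Finset.mem_filter.1 hm).2], ← map_sum, hcoeff, map_zero]
  rw [c.as_sum, ← sub_zero (∑ m ∈ c.support, _), ← hzero, ← Finset.sum_sub_distrib]
  exact J.sum_mem fun m _ => hfib _ _ (hr m).symm _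

lemma window_ne_zero (k : ZMod (2 * n + 1)) : window K k ≠ 0 :=
  Finset.prod_ne_zero_iff.2 fun _ _ => X_ne_zero _

end ToricMap

section KillVars

variable {σ K : Type*} [Field K]

lemma sub_mem_of_X_sub_mem (φ : MvPolynomial σ K →ₐ[K] MvPolynomial σ K)
    (J : Ideal (MvPolynomial σ K)) (h : ∀ i, X i - φ (X i) ∈ J) (f : MvPolynomial σ K) :
    f - φ f ∈ J := by
  have : Ideal.Quotient.mkₐ K J = (Ideal.Quotient.mkₐ K J).comp φ := by
    ext i
    exact Ideal.Quotient.eq.2 (h i)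
  exact Ideal.Quotient.eq.1 (AlgHom.congr_fun this f)

variable [DecidableEq σ]

/-- The substitution setting the variables in `F` to zero. -/
noncomputable def killVars (K : Type*) [Field K] (F : Finset σ) :
    MvPolynomial σ K →ₐ[K] MvPolynomial σ K :=
  aeval fun e => if e ∈ F then 0 else X e

lemma killVars_X_of_mem {F : Finset σ} {e : σ} (h : e ∈ F) :
    killVars K F (X e) = 0 := by
  simp [killVars, h]

lemma killVars_X_of_notMem {F : Finset σ} {e : σ} (h : e ∉ F) :
    killVars K F (X e) = X e := by
  simp [killVars, h]

lemma killVars_eq_zero_iff {F : Finset σ} {f : MvPolynomial σ K} :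
    killVars K F f = 0 ↔ f ∈ Ideal.span (X '' (F : Set σ)) := by
  constructor
  · intro h
    rw [← sub_zero f, ← h]
    refine sub_mem_of_X_sub_mem _ _ (fun e => ?_) f
    by_cases he : e ∈ F
    · rw [killVars_X_of_mem he, sub_zero]
      exact Ideal.subset_span ⟨e, he, rfl⟩
    · rw [killVars_X_of_notMem he, sub_self]
      exact Ideal.zero_mem _
  · intro h
    have : Ideal.span (X '' (F : Set σ)) ≤ RingHom.ker (killVars K F) := by
      rw [Ideal.span_le]
      rintro _ ⟨e, he, rfl⟩
      exact killVars_X_of_mem he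
    exact this h

lemma killVars_insert (F : Finset σ) (e : σ) (f : MvPolynomial σ K) :
    killVars K (insert e F) f = killVars K {e} (killVars K F f) := by
  have : killVars K (insert e F) = (killVars K {e}).comp (killVars K F) := by
    ext i
    by_cases hi : i ∈ F
    · simp [killVars, hi]
    · simp [killVars, hi]
  rw [this]; rfl

lemma isPermutableRegular_image_X [DecidableEq (MvPolynomial σ K)] (J : Ideal (MvPolynomial σ K))
    (Y : Finset σ)
    (h : ∀ (F : Finset σ) (e : σ), insert e F ⊆ Y → e ∉ F → ∀ f,
      X e * f ∈ J ⊔ Ideal.span (X '' (F : Set σ)) → f ∈ J ⊔ Ideal.span (X '' (F : Set σ))) :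
    IsPermutableRegular J (Y.image X) := by
  intro F a hFa ha f hf
  obtain ⟨e, heY, rfl⟩ := Finset.mem_image.1 (hFa (Finset.mem_insert_self _ _))
  have hF : F = (Y.filter fun e => X e ∈ F).image X := by
    ext x
    rw [Finset.mem_image]
    constructor
    · intro hx
      obtain ⟨e', he', rfl⟩ := Finset.mem_image.1 (hFa (Finset.mem_insert_of_mem hx))
      exact ⟨e', Finset.mem_filter.2 ⟨he', hx⟩, rfl⟩
    · rintro ⟨e', he', rfl⟩
      exact (Finset.mem_filter.1 he').2
  have hF' : (F : Set (MvPolynomial σ K)) =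
      X '' ((Y.filter fun e => X e ∈ F : Finset σ) : Set σ) := by
    conv_lhs => rw [hF]
    rw [Finset.coe_image]
  rw [hF'] at hf ⊢
  refine h _ e (Finset.insert_subset heY (Finset.filter_subset _ _)) (fun h' => ?_) f hf
  exact ha (Finset.mem_filter.1 h').2

lemma isPermutableRegular_bot_image_X [DecidableEq (MvPolynomial σ K)] (Y : Finset σ) :
    IsPermutableRegular (⊥ : Ideal (MvPolynomial σ K)) (Y.image X) := by
  refine isPermutableRegular_image_X _ _ fun F e _ he f hf => ?_
  rw [bot_sup_eq, ← killVars_eq_zero_iff] at hf ⊢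
  rw [map_mul, killVars_X_of_notMem he] at hf
  exact (mul_eq_zero.1 hf).resolve_left (X_ne_zero e)

end KillVars

section Homogeneous

attribute [local instance] MvPolynomial.gradedAlgebra

lemma mem_of_forall_mem_sup_pow {σ K : Type*} [Field K] {B : Ideal (MvPolynomial σ K)}
    (hB : B.IsHomogeneous (homogeneousSubmodule σ K)) (y : σ) (z : MvPolynomial σ K)
    (h : ∀ k : ℕ, ∃ r, z - X y ^ k * r ∈ B) : z ∈ B := by
  obtain ⟨r, hr⟩ := h (z.totalDegree + 1)
  rw [← z.sum_homogeneousComponent]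
  refine B.sum_mem fun i hi => ?_
  have h1 := homogeneousComponent_mem_of_mem hB hr i
  have h2 : homogeneousComponent i (X y ^ (z.totalDegree + 1) * r) = 0 := by
    classical
    ext m
    rw [coeff_homogeneousComponent, coeff_zero]
    split_ifs with hm
    · rw [X_pow_eq_monomial, coeff_monomial_mul', if_neg]
      intro hle
      have h3 := Finsupp.degree_mono hle
      rw [hm, Finsupp.degree_single] at h3
      rw [Finset.mem_range] at hi
      omega
    · rfl
  rwa [map_sub, h2, sub_zero] at h1

end Homogeneous

section Rees

variable {E ν K : Type*} [Field K] (P : ν → MvPolynomial E K)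

/-- The map presenting the Rees algebra of the ideal generated by the `P k`. -/
noncomputable def reesMap : MvPolynomial (E ⊕ ν) K →ₐ[K] Polynomial (MvPolynomial E K) :=
  aeval (Sum.elim (fun e => Polynomial.C (X e)) (fun k => Polynomial.C (P k) * Polynomial.X))

lemma reesMap_rename (f : MvPolynomial E K) :
    reesMap P (rename Sum.inl f) = Polynomial.C f := by
  have : (reesMap P).comp (rename Sum.inl) = Polynomial.CAlgHom := by
    ext e
    simp [reesMap]
  exact AlgHom.congr_fun this f

lemma reesMap_X_inl (e : E) : reesMap P (X (Sum.inl e)) = Polynomial.C (X e) := by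
  simp [reesMap]

lemma reesMap_X_inr (k : ν) :
    reesMap P (X (Sum.inr k)) = Polynomial.C (P k) * Polynomial.X := by
  simp [reesMap]

lemma exists_reesMap_eq_monomial (d : ℕ) (f : MvPolynomial E K)
    (hf : f ∈ Ideal.span (Set.range P) ^ d) : ∃ c, reesMap P c = Polynomial.monomial d f := by
  let T : ℕ → Ideal (MvPolynomial E K) := fun d =>
    { carrier := {f | ∃ c, reesMap P c = Polynomial.monomial d f}
      add_mem' := by
        rintro a b ⟨c, hc⟩ ⟨c', hc'⟩
        exact ⟨c + c', by rw [map_add, hc, hc', map_add]⟩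
      zero_mem' := ⟨0, by simp⟩
      smul_mem' := by
        rintro r a ⟨c, hc⟩
        exact ⟨rename Sum.inl r * c, by
          rw [map_mul, hc, reesMap_rename, Polynomial.C_mul_monomial, smul_eq_mul]⟩ }
  suffices h : Ideal.span (Set.range P) ^ d ≤ T d from h hf
  clear hf
  induction d with
  | zero => exact fun r _ => ⟨rename Sum.inl r, by rw [reesMap_rename]; rfl⟩
  | succ d ih =>
    have h1 : Ideal.span (Set.range P) ≤ T 1 := by
      rw [Ideal.span_le]
      rintro _ ⟨k, rfl⟩
      exact ⟨X (Sum.inr k), by rw [reesMap_X_inr, Polynomial.C_mul_X_eq_monomial]⟩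
    rw [pow_succ, Ideal.mul_le]
    intro r hr s hs
    obtain ⟨c, hc⟩ := ih hr
    obtain ⟨c', hc'⟩ := h1 hs
    exact ⟨c * c', by rw [map_mul, hc, hc', Polynomial.monomial_mul_monomial]⟩

lemma coeff_reesMap_mem (d : ℕ) (c : MvPolynomial (E ⊕ ν) K) :
    (reesMap P c).coeff d ∈ Ideal.span (Set.range P) ^ d := by
  have : reesMap P c ∈ reesAlgebra (Ideal.span (Set.range P)) := by
    induction c using MvPolynomial.induction_on with
    | C a =>
      rw [← algebraMap_eq, AlgHom.commutes,
        IsScalarTower.algebraMap_apply K (MvPolynomial E K)]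
      exact Subalgebra.algebraMap_mem _ _
    | add p q hp hq => rw [map_add]; exact Subalgebra.add_mem _ hp hq
    | mul_X p i hp =>
      rw [map_mul]
      refine Subalgebra.mul_mem _ hp ?_
      rcases i with e | k
      · rw [reesMap_X_inl]
        exact Subalgebra.algebraMap_mem _ (X e)
      · rw [reesMap_X_inr, Polynomial.C_mul_X_eq_monomial, reesAlgebra.monomial_mem, pow_one]
        exact Ideal.subset_span ⟨k, rfl⟩
  exact (mem_reesAlgebra_iff _ _).1 this d

end Rees

section Linkage

variable {E ν K : Type*} [Field K] {P : ν → MvPolynomial E K}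

/-- The linear form `∑ L j T_j`. -/
noncomputable def linearRelation [Fintype ν] (L : ν → MvPolynomial E K) :
    MvPolynomial (E ⊕ ν) K :=
  ∑ j, rename Sum.inl (L j) * X (Sum.inr j)

lemma reesMap_linearRelation [Fintype ν] {L : ν → MvPolynomial E K} (h : ∑ j, L j * P j = 0) :
    reesMap P (linearRelation L) = 0 := by
  have h1 : ∀ j, reesMap P (rename Sum.inl (L j) * X (Sum.inr j)) =
      Polynomial.CAlgHom (R := K) (L j * P j) * Polynomial.X := by
    intro j
    rw [map_mul, reesMap_rename, reesMap_X_inr, ← mul_assoc, map_mul]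
    rfl
  rw [linearRelation, map_sum, Finset.sum_congr rfl fun j _ => h1 j, ← Finset.sum_mul,
    ← map_sum, h, map_zero, zero_mul]

variable [DecidableEq E]

/-- Modulo the variables in `F`, every relation between the `P k` is a consequence of `B`. -/
def GeneratesRelations (P : ν → MvPolynomial E K) (B : Ideal (MvPolynomial (E ⊕ ν) K))
    (F : Finset E) : Prop :=
  ∀ c, (reesMap P c).map (killVars K F : MvPolynomial E K →+* MvPolynomial E K) = 0 →
    c ∈ B ⊔ Ideal.span (X '' (Sum.inl '' (F : Set E)))

lemma map_killVars_reesMap_eq_zero {B : Ideal (MvPolynomial (E ⊕ ν) K)}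
    (hB : ∀ b ∈ B, reesMap P b = 0) (F : Finset E) {c : MvPolynomial (E ⊕ ν) K}
    (hc : c ∈ B ⊔ Ideal.span (X '' (Sum.inl '' (F : Set E)))) :
    (reesMap P c).map (killVars K F : MvPolynomial E K →+* MvPolynomial E K) = 0 := by
  have : B ⊔ Ideal.span (X '' (Sum.inl '' (F : Set E))) ≤
      RingHom.ker ((Polynomial.mapRingHom
        (killVars K F : MvPolynomial E K →+* MvPolynomial E K)).comp
        (reesMap P : MvPolynomial (E ⊕ ν) K →+* _)) := by
    refine sup_le (fun b hb => ?_) (Ideal.span_le.2 ?_)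
    · simp [RingHom.mem_ker, hB b hb]
    · rintro _ ⟨_, ⟨e, he, rfl⟩, rfl⟩
      simp [RingHom.mem_ker, reesMap_X_inl, killVars_X_of_mem (Finset.mem_coe.1 he)]
  exact this hc

lemma mem_span_X_insert_iff {B : Ideal (MvPolynomial (E ⊕ ν) K)} {F : Finset E} {y : E}
    {z : MvPolynomial (E ⊕ ν) K} :
    z ∈ B ⊔ Ideal.span (X '' (Sum.inl '' ((insert y F : Finset E) : Set E))) ↔
      ∃ r, z - X (Sum.inl y) * r ∈ B ⊔ Ideal.span (X '' (Sum.inl '' (F : Set E))) := by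
  rw [Finset.coe_insert, Set.image_insert_eq, Set.image_insert_eq, Ideal.span_insert,
    sup_left_comm, sup_comm, Submodule.mem_sup]
  constructor
  · rintro ⟨b, hb, x, hx, rfl⟩
    obtain ⟨r, rfl⟩ := Ideal.mem_span_singleton'.1 hx
    exact ⟨r, by rwa [mul_comm r, add_sub_cancel_right]⟩
  · rintro ⟨r, hr⟩
    exact ⟨_, hr, X (Sum.inl y) * r, Ideal.mem_span_singleton'.2 ⟨r, mul_comm _ _⟩, by ring⟩

attribute [local instance] MvPolynomial.gradedAlgebra in
lemma GeneratesRelations.of_insert {B : Ideal (MvPolynomial (E ⊕ ν) K)}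
    (hB : ∀ b ∈ B, reesMap P b = 0) (hBh : B.IsHomogeneous (homogeneousSubmodule (E ⊕ ν) K))
    {F : Finset E} {y : E} (hy : y ∉ F) (h : GeneratesRelations P B (insert y F)) :
    GeneratesRelations P B F := by
  have hBF : (B ⊔ Ideal.span (X '' (Sum.inl '' (F : Set E)))).IsHomogeneous
      (homogeneousSubmodule (E ⊕ ν) K) := by
    refine hBh.sup (Ideal.homogeneous_span _ _ ?_)
    rintro _ ⟨e, -, rfl⟩
    exact ⟨1, isHomogeneous_X K e⟩
  have hstep : ∀ z, (reesMap P z).map (killVars K F : MvPolynomial E K →+* MvPolynomial E K) = 0 →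
      ∃ r, z - X (Sum.inl y) * r ∈ B ⊔ Ideal.span (X '' (Sum.inl '' (F : Set E))) ∧
        (reesMap P r).map (killVars K F : MvPolynomial E K →+* MvPolynomial E K) = 0 := by
    intro z hz
    have hz' : (reesMap P z).map
        (killVars K (insert y F) : MvPolynomial E K →+* MvPolynomial E K) = 0 := by
      have : (killVars K (insert y F) : MvPolynomial E K →+* MvPolynomial E K) =
          (killVars K {y} : MvPolynomial E K →+* MvPolynomial E K).comp (killVars K F) :=
        RingHom.ext (killVars_insert F y)
      rw [this, ← Polynomial.map_map, hz, Polynomial.map_zero]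
    obtain ⟨r, hr⟩ := mem_span_X_insert_iff.1 (h z hz')
    refine ⟨r, hr, ?_⟩
    have := map_killVars_reesMap_eq_zero hB F hr
    rw [map_sub, Polynomial.map_sub, hz, zero_sub, neg_eq_zero, map_mul, reesMap_X_inl,
      Polynomial.map_mul, Polynomial.map_C, RingHom.coe_coe, killVars_X_of_notMem hy] at this
    exact (mul_eq_zero.1 this).resolve_left (by simp [X_ne_zero])
  intro z hz
  refine mem_of_forall_mem_sup_pow hBF (Sum.inl y) z fun k => ?_
  suffices ∃ r, z - X (Sum.inl y) ^ k * r ∈ B ⊔ Ideal.span (X '' (Sum.inl '' (F : Set E))) ∧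
      (reesMap P r).map (killVars K F : MvPolynomial E K →+* MvPolynomial E K) = 0 from
    this.imp fun r hr => hr.1
  induction k with
  | zero => exact ⟨z, by simp, hz⟩
  | succ k ih =>
    obtain ⟨r, hr, hr0⟩ := ih
    obtain ⟨r', hr', hr0'⟩ := hstep r hr0
    refine ⟨r', ?_, hr0'⟩
    have := Ideal.add_mem _ hr (Ideal.mul_mem_left _ (X (Sum.inl y) ^ k) hr')
    convert this using 1
    ring

attribute [local instance] MvPolynomial.gradedAlgebra in
lemma GeneratesRelations.of_subset {B : Ideal (MvPolynomial (E ⊕ ν) K)}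
    (hB : ∀ b ∈ B, reesMap P b = 0) (hBh : B.IsHomogeneous (homogeneousSubmodule (E ⊕ ν) K))
    {Y : Finset E} (h : GeneratesRelations P B Y) {F : Finset E} (hF : F ⊆ Y) :
    GeneratesRelations P B F := by
  suffices ∀ G F : Finset E, F ∪ G = Y → GeneratesRelations P B F from
    this Y F (Finset.union_eq_right.2 hF)
  intro G
  induction G using Finset.induction with
  | empty =>
    intro F hF
    rw [Finset.union_empty] at hF
    exact hF ▸ h
  | insert a G _ ih =>
    intro F hF
    by_cases ha : a ∈ F
    · refine ih F ?_
      rwa [Finset.union_insert, Finset.insert_eq_of_mem (Finset.mem_union_left _ ha)] at hF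
    · refine (ih (insert a F) ?_).of_insert hB hBh ha
      rwa [Finset.insert_union, ← Finset.union_insert]

lemma GeneratesRelations.mem_of_X_mul_mem {B : Ideal (MvPolynomial (E ⊕ ν) K)}
    (hB : ∀ b ∈ B, reesMap P b = 0) {F : Finset E} {y : E} (hy : y ∉ F)
    (h : GeneratesRelations P B (insert y F)) (d : ℕ) (f : MvPolynomial E K)
    (hf : X y * f ∈ Ideal.span (Set.range P) ^ d ⊔ Ideal.span (X '' (F : Set E))) :
    f ∈ Ideal.span (Set.range P) ^ d ⊔ Ideal.span (X '' (F : Set E)) := by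
  obtain ⟨p, hp, q, hq, hpq⟩ := Submodule.mem_sup.1 hf
  obtain ⟨c, hc⟩ := exists_reesMap_eq_monomial P d p hp
  have hq' := killVars_eq_zero_iff.2 hq
  have hc' : (reesMap P c).map
      (killVars K (insert y F) : MvPolynomial E K →+* MvPolynomial E K) = 0 := by
    have hp' : killVars K (insert y F) p = 0 := by
      rw [killVars_insert, eq_sub_of_add_eq hpq, map_sub, hq', sub_zero, map_mul, map_mul,
        killVars_X_of_notMem hy, killVars_X_of_mem (Finset.mem_singleton_self y), zero_mul]
    rw [hc, Polynomial.map_monomial, RingHom.coe_coe, hp', map_zero]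
  obtain ⟨r, hr⟩ := mem_span_X_insert_iff.1 (h c hc')
  have h1 := congrArg (fun g => Polynomial.coeff g d) (map_killVars_reesMap_eq_zero hB F hr)
  simp only [Polynomial.coeff_map, map_sub, map_mul, reesMap_X_inl, Polynomial.coeff_sub,
    Polynomial.coeff_C_mul, hc, Polynomial.coeff_monomial, if_true, RingHom.coe_coe,
    Polynomial.coeff_zero, killVars_X_of_notMem hy] at h1
  have h2 : killVars K F (f - (reesMap P r).coeff d) = 0 := by
    have h3 : X y * killVars K F (f - (reesMap P r).coeff d) = 0 := by
      have h4 := congrArg (killVars K F) hpq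
      rw [map_add, hq', add_zero, map_mul, killVars_X_of_notMem hy] at h4
      rw [map_sub, mul_sub, ← h4]
      exact h1
    exact (mul_eq_zero.1 h3).resolve_left (X_ne_zero y)
  rw [← add_sub_cancel ((reesMap P r).coeff d) f]
  exact Submodule.add_mem_sup (coeff_reesMap_mem P d r) (killVars_eq_zero_iff.1 h2)

attribute [local instance] MvPolynomial.gradedAlgebra in
lemma GeneratesRelations.isPermutableRegular [DecidableEq (MvPolynomial E K)]
    {B : Ideal (MvPolynomial (E ⊕ ν) K)}
    (hB : ∀ b ∈ B, reesMap P b = 0) (hBh : B.IsHomogeneous (homogeneousSubmodule (E ⊕ ν) K))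
    {Y : Finset E} (h : GeneratesRelations P B Y) (d : ℕ) :
    IsPermutableRegular (Ideal.span (Set.range P) ^ d) (Y.image X) :=
  isPermutableRegular_image_X _ _ fun _ _ hF hy f hf =>
    (h.of_subset hB hBh hF).mem_of_X_mul_mem hB hy d f hf

end Linkage

section Specialization

variable {n : ℕ} {E K : Type*} [Field K]

/-- A specialization of the linearly related forms `P k` to the windows of length `n`, which sets
the variables in `Y` to zero and has a section `ι`. -/
structure ToricSpecialization (P : ZMod (2 * n + 1) → MvPolynomial E K) (Y : Finset E) where
  /-- The specialization. -/
  π : MvPolynomial E K →ₐ[K] MvPolynomial (ZMod (2 * n + 1)) K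
  /-- The section. -/
  ι : MvPolynomial (ZMod (2 * n + 1)) K →ₐ[K] MvPolynomial E K
  /-- The variables not in `Y`. -/
  e : ZMod (2 * n + 1) → E
  /-- The signs in the section. -/
  ε : ZMod (2 * n + 1) → K
  /-- The linear relations between the `P k`. -/
  L : ZMod (2 * n + 1) → ZMod (2 * n + 1) → MvPolynomial E K
  π_ι : ∀ k, π (ι (X k)) = X k
  π_X : ∀ x ∈ Y, π (X x) = 0
  ι_π : ∀ x ∉ Y, ι (π (X x)) = X x
  π_P : ∀ k, π (P k) = window K k
  e_injective : Function.Injective e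
  e_notMem : ∀ k, e k ∉ Y
  ε_ne_zero : ∀ k, ε k ≠ 0
  ι_X : ∀ k, ι (X k) = C (ε k) * X (e k)
  L_isHomogeneous : ∀ k j, (L k j).IsHomogeneous 1
  sum_L_mul : ∀ k, ∑ j, L k j * P j = 0
  π_L : ∀ k j, π (L k j) = (if j = k then X k else 0) - if j = k + 1 then X (k - n) else 0

namespace ToricSpecialization

variable {P : ZMod (2 * n + 1) → MvPolynomial E K} {Y : Finset E} (T : ToricSpecialization P Y)

/-- The ideal generated by the linear relations between the `P k`. -/
noncomputable def relationIdeal : Ideal (MvPolynomial (E ⊕ ZMod (2 * n + 1)) K) :=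
  Ideal.span (Set.range fun k => linearRelation (T.L k))

lemma reesMap_eq_zero {b : MvPolynomial (E ⊕ ZMod (2 * n + 1)) K} (hb : b ∈ T.relationIdeal) :
    reesMap P b = 0 := by
  have : T.relationIdeal ≤ RingHom.ker (reesMap P) := by
    refine Ideal.span_le.2 ?_
    rintro _ ⟨k, rfl⟩
    exact reesMap_linearRelation (T.sum_L_mul k)
  exact this hb

attribute [local instance] MvPolynomial.gradedAlgebra in
lemma relationIdeal_isHomogeneous :
    T.relationIdeal.IsHomogeneous (homogeneousSubmodule (E ⊕ ZMod (2 * n + 1)) K) := by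
  refine Ideal.homogeneous_span _ _ ?_
  rintro _ ⟨k, rfl⟩
  exact ⟨2, IsHomogeneous.sum _ _ _ fun j _ =>
    (T.L_isHomogeneous k j).rename_isHomogeneous.mul (isHomogeneous_X K _)⟩

/-- The specialization of the `E`-variables, keeping the other variables. -/
noncomputable def πT : MvPolynomial (E ⊕ ZMod (2 * n + 1)) K →ₐ[K]
    MvPolynomial (ZMod (2 * n + 1) ⊕ ZMod (2 * n + 1)) K :=
  aeval (Sum.elim (fun x => rename Sum.inl (T.π (X x))) (fun k => X (Sum.inr k)))

/-- The section of `πT`. -/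
noncomputable def ιT : MvPolynomial (ZMod (2 * n + 1) ⊕ ZMod (2 * n + 1)) K →ₐ[K]
    MvPolynomial (E ⊕ ZMod (2 * n + 1)) K :=
  aeval (Sum.elim (fun k => rename Sum.inl (T.ι (X k))) (fun k => X (Sum.inr k)))

lemma πT_rename (f : MvPolynomial E K) : T.πT (rename Sum.inl f) = rename Sum.inl (T.π f) := by
  have : T.πT.comp (rename Sum.inl) = (rename Sum.inl).comp T.π := by
    ext x : 1
    simp [πT]
  exact AlgHom.congr_fun this f

lemma ιT_rename (f : MvPolynomial (ZMod (2 * n + 1)) K) :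
    T.ιT (rename Sum.inl f) = rename Sum.inl (T.ι f) := by
  have : T.ιT.comp (rename Sum.inl) = (rename Sum.inl).comp T.ι := by
    ext x : 1
    simp [ιT]
  exact AlgHom.congr_fun this f

lemma πT_linearRelation (k : ZMod (2 * n + 1)) :
    T.πT (linearRelation (T.L k)) = toricRelation K k := by
  have h : ∀ j, T.πT (X (Sum.inr j)) = X (Sum.inr j) := fun j => by simp [πT]
  simp only [linearRelation, map_sum, map_mul, πT_rename, T.π_L, h, map_sub, sub_mul,
    Finset.sum_sub_distrib, apply_ite (rename Sum.inl), map_zero, ite_mul, zero_mul,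
    Finset.sum_ite_eq', Finset.mem_univ, if_true, rename_X, toricRelation]

lemma toricMap_πT (c : MvPolynomial (E ⊕ ZMod (2 * n + 1)) K) :
    toricMap K n (T.πT c) = Polynomial.mapAlgHom T.π (reesMap P c) := by
  have : (toricMap K n).comp T.πT = (Polynomial.mapAlgHom T.π).comp (reesMap P) := by
    have h : (toricMap K n).comp (rename Sum.inl) = Polynomial.CAlgHom := by
      ext k : 1
      simp [toricMap]
    ext x : 1
    rcases x with x | k
    · have := AlgHom.congr_fun h (T.π (X x))
      simpa [πT, reesMap_X_inl] using this
    · simp [πT, toricMap, reesMap_X_inr, T.π_P]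
  exact AlgHom.congr_fun this c

variable [DecidableEq E]

lemma π_killVars (f : MvPolynomial E K) : T.π (killVars K Y f) = T.π f := by
  have : T.π.comp (killVars K Y) = T.π := by
    ext x : 1
    by_cases hx : x ∈ Y
    · simp [killVars_X_of_mem hx, T.π_X x hx]
    · simp [killVars_X_of_notMem hx]
  exact AlgHom.congr_fun this f

lemma generatesRelations : GeneratesRelations P T.relationIdeal Y := by
  intro c hc
  let B := T.relationIdeal ⊔ Ideal.span (X '' (Sum.inl '' (Y : Set E)))
  have hsub : ∀ z, z - T.ιT (T.πT z) ∈ B := by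
    refine sub_mem_of_X_sub_mem (T.ιT.comp T.πT) B fun x => ?_
    rcases x with x | k
    · by_cases hx : x ∈ Y
      · have : T.πT (X (Sum.inl x)) = 0 := by simp [πT, T.π_X x hx]
        rw [AlgHom.comp_apply, this, map_zero, sub_zero]
        exact Ideal.mem_sup_right (Ideal.subset_span ⟨_, ⟨x, hx, rfl⟩, rfl⟩)
      · have : T.πT (X (Sum.inl x)) = rename Sum.inl (T.π (X x)) := by simp [πT]
        rw [AlgHom.comp_apply, this, ιT_rename, T.ι_π x hx, rename_X, sub_self]
        exact B.zero_mem
    · have : (T.ιT.comp T.πT) (X (Sum.inr k)) = X (Sum.inr k) := by simp [ιT, πT]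
      rw [this, sub_self]
      exact B.zero_mem
  have hker : toricMap K n (T.πT c) = 0 := by
    have h1 : (T.π : MvPolynomial E K →+* MvPolynomial (ZMod (2 * n + 1)) K).comp
        (killVars K Y : MvPolynomial E K →+* MvPolynomial E K) =
        (T.π : MvPolynomial E K →+* MvPolynomial (ZMod (2 * n + 1)) K) := RingHom.ext T.π_killVars
    rw [toricMap_πT]
    change (reesMap P c).map (T.π : MvPolynomial E K →+* MvPolynomial (ZMod (2 * n + 1)) K) = 0
    rw [← h1, ← Polynomial.map_map, hc, Polynomial.map_zero]
  have hmem : T.πT c ∈ B.comap T.ιT := by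
    refine mem_of_toricMap_eq_zero _ (fun k => ?_) _ hker
    have := B.sub_mem (Ideal.mem_sup_left (Ideal.subset_span ⟨k, rfl⟩) :
      linearRelation (T.L k) ∈ B) (hsub (linearRelation (T.L k)))
    rwa [sub_sub_cancel, πT_linearRelation] at this
  have := B.add_mem (hsub c) hmem
  rwa [sub_add_cancel] at this

lemma isPermutableRegular (T : ToricSpecialization P Y) [DecidableEq (MvPolynomial E K)] (d : ℕ) :
    IsPermutableRegular (Ideal.span (Set.range P) ^ d) (Y.image X) :=
  T.generatesRelations.isPermutableRegular (fun _ hb => T.reesMap_eq_zero hb)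
    T.relationIdeal_isHomogeneous d

end ToricSpecialization

end Specialization

section AssociatedPrime

variable {n : ℕ}

/-- The indices of the variables in the window preceding `k`. -/
def windowSupport (k : ZMod (2 * n + 1)) : Finset (ZMod (2 * n + 1)) :=
  Finset.univ.filter fun c => (c.val < k.val ∧ k.val ≤ c.val + n) ∨ k.val + n + 1 ≤ c.val

lemma mem_windowSupport {k c : ZMod (2 * n + 1)} : c ∈ windowSupport k ↔
    (c.val < k.val ∧ k.val ≤ c.val + n) ∨ k.val + n + 1 ≤ c.val := by
  simp [windowSupport]

lemma natCast_eq_of_add_eq {k : ZMod (2 * n + 1)} {a b : ℕ} (h : a + b = k.val) :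
    k - (b : ZMod (2 * n + 1)) = a := by
  rw [sub_eq_iff_eq_add, ← Nat.cast_add, h, ZMod.natCast_zmod_val]

lemma natCast_eq_of_add_eq_add {k : ZMod (2 * n + 1)} {a b : ℕ}
    (h : a + b = k.val + (2 * n + 1)) : k - (b : ZMod (2 * n + 1)) = a := by
  rw [sub_eq_iff_eq_add, ← Nat.cast_add, h, Nat.cast_add, ZMod.natCast_self, add_zero,
    ZMod.natCast_zmod_val]

variable {K : Type*} [Field K]

lemma window_eq_prod_windowSupport (k : ZMod (2 * n + 1)) :
    window K k = ∏ c ∈ windowSupport k, X c := by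
  have hk := k.val_lt
  refine Finset.prod_nbij (fun i => k - ((i + 1 : ℕ) : ZMod (2 * n + 1))) ?_ ?_ ?_ fun _ _ => rfl
  · intro i hi
    rw [Finset.mem_range] at hi
    rw [mem_windowSupport]
    by_cases h : i + 1 ≤ k.val
    · rw [natCast_eq_of_add_eq (a := k.val - (i + 1)) (by omega), ZMod.val_cast_of_lt (by omega)]
      omega
    · rw [natCast_eq_of_add_eq_add (a := k.val + (2 * n + 1) - (i + 1)) (by omega),
        ZMod.val_cast_of_lt (by omega)]
      omega
  · intro i hi j hj hij
    rw [Finset.coe_range, Set.mem_Iio] at hi hj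
    have h1 := congrArg ZMod.val (sub_right_injective hij)
    rw [ZMod.val_cast_of_lt (by omega), ZMod.val_cast_of_lt (by omega)] at h1
    omega
  · intro c hc
    have hc' := c.val_lt
    rw [Finset.mem_coe, mem_windowSupport] at hc
    rcases hc with h | h
    · refine ⟨k.val - c.val - 1, ?_, ?_⟩
      · rw [Finset.coe_range, Set.mem_Iio]; omega
      · simp only
        rw [natCast_eq_of_add_eq (a := c.val) (by omega), ZMod.natCast_zmod_val]
    · refine ⟨k.val + (2 * n + 1) - c.val - 1, ?_, ?_⟩
      · rw [Finset.coe_range, Set.mem_Iio]; omega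
      · simp only
        rw [natCast_eq_of_add_eq_add (a := c.val) (by omega), ZMod.natCast_zmod_val]

/-- The indices of the variables generating the associated prime of codimension `2s + 1`. -/
def primeSupport (n s : ℕ) : Finset (ZMod (2 * n + 1)) :=
  Finset.univ.filter fun c => c.val < s ∨ (n ≤ c.val ∧ c.val ≤ n + s)

lemma mem_primeSupport {s : ℕ} {c : ZMod (2 * n + 1)} :
    c ∈ primeSupport n s ↔ c.val < s ∨ (n ≤ c.val ∧ c.val ≤ n + s) := by
  simp [primeSupport]

lemma card_primeSupport {s : ℕ} (hs : s ≤ n) : (primeSupport n s).card = 2 * s + 1 := by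
  rw [← Finset.card_range (2 * s + 1)]
  refine (Finset.card_nbij'
    (fun i => if i < s then (i : ZMod (2 * n + 1)) else ((n + (i - s) : ℕ) : ZMod (2 * n + 1)))
    (fun c => if c.val < s then c.val else c.val - n + s) ?_ ?_ ?_ ?_).symm
  · intro i hi
    rw [Finset.coe_range, Set.mem_Iio] at hi
    rw [Finset.mem_coe, mem_primeSupport]
    simp only
    split_ifs
    · rw [ZMod.val_cast_of_lt (by omega)]; omega
    · rw [ZMod.val_cast_of_lt (by omega)]; omega
  · intro c hc
    rw [Finset.mem_coe, mem_primeSupport] at hc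
    rw [Finset.coe_range, Set.mem_Iio]
    simp only
    split_ifs <;> omega
  · intro i hi
    rw [Finset.coe_range, Set.mem_Iio] at hi
    by_cases h : i < s
    · simp only [if_pos h]
      rw [ZMod.val_cast_of_lt (by omega), if_pos h]
    · simp only [if_neg h]
      rw [ZMod.val_cast_of_lt (by omega), if_neg (by omega)]
      omega
  · intro c hc
    rw [Finset.mem_coe, mem_primeSupport] at hc
    by_cases h : c.val < s
    · simp only [if_pos h, ZMod.natCast_zmod_val]
    · simp only [if_neg h]
      rw [if_neg (by omega), show n + (c.val - n + s - s) = c.val by omega, ZMod.natCast_zmod_val]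

lemma le_card_windowSupport_inter {s : ℕ} (hs : s ≤ n) (k : ZMod (2 * n + 1)) :
    s ≤ (windowSupport k ∩ primeSupport n s).card := by
  have hk := k.val_lt
  conv_lhs => rw [← Finset.card_range s]
  let f : ℕ → ℕ := fun t => if k.val ≤ t then n + t + 1 else if k.val ≤ t + n then t else n + t
  have hf : ∀ t < s, f t < 2 * n + 1 := by
    intro t ht
    simp only [f]
    split_ifs <;> omega
  refine Finset.card_le_card_of_injOn (fun t => (f t : ZMod (2 * n + 1))) ?_ ?_
  · intro t ht
    rw [Finset.coe_range, Set.mem_Iio] at ht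
    rw [Finset.mem_coe, Finset.mem_inter, mem_windowSupport, mem_primeSupport,
      ZMod.val_cast_of_lt (hf t ht)]
    simp only [f]
    split_ifs <;> omega
  · intro t ht t' ht' h
    rw [Finset.coe_range, Set.mem_Iio] at ht ht'
    have h1 := congrArg ZMod.val h
    simp only at h1
    rw [ZMod.val_cast_of_lt (hf t ht), ZMod.val_cast_of_lt (hf t' ht')] at h1
    simp only [f] at h1
    split_ifs at h1 <;> omega

lemma card_windowSupport_inter_le {s : ℕ} :
    (windowSupport (n : ZMod (2 * n + 1)) ∩ primeSupport n s).card ≤ s := by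
  conv_rhs => rw [← Finset.card_range s]
  refine Finset.card_le_card_of_injOn ZMod.val ?_ (ZMod.val_injective _).injOn
  intro c hc
  have := c.val_lt
  rw [Finset.mem_coe, Finset.mem_inter, mem_windowSupport, mem_primeSupport,
    ZMod.val_cast_of_lt (by omega)] at hc
  rw [Finset.coe_range, Set.mem_Iio]
  omega

lemma card_filter_mem_windowSupport_le {s : ℕ} {c : ZMod (2 * n + 1)}
    (hc : c ∈ primeSupport n s) :
    ((primeSupport n s).filter fun k => c ∈ windowSupport k).card ≤ s := by
  rw [mem_primeSupport] at hc
  conv_rhs => rw [← Finset.card_range s]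
  refine Finset.card_le_card_of_injOn
    (fun k => if k.val < s then k.val else if c.val < s then k.val - n else k.val - n - 1) ?_ ?_
  · intro k hk
    rw [Finset.mem_coe, Finset.mem_filter, mem_windowSupport, mem_primeSupport] at hk
    rw [Finset.coe_range, Set.mem_Iio]
    have := c.val_lt
    simp only
    split_ifs <;> omega
  · intro k hk k' hk' h
    rw [Finset.mem_coe, Finset.mem_filter, mem_windowSupport, mem_primeSupport] at hk hk'
    apply ZMod.val_injective
    have := c.val_lt
    simp only at h
    split_ifs at h <;> omega

lemma exists_pair_covering {s : ℕ} (hs : 1 ≤ s) (hsn : s ≤ n) {a : ZMod (2 * n + 1)}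
    (ha : a ∈ primeSupport n s) : ∃ p ∈ primeSupport n s, ∃ q ∈ primeSupport n s, p ≠ q ∧
      ∀ c ∈ primeSupport n s, c ≠ a → c ∈ windowSupport p ∨ c ∈ windowSupport q := by
  have key : ∀ q : ℕ, q < 2 * n + 1 → a.val ≠ q → (q < s ∨ (n ≤ q ∧ q ≤ n + s)) →
      (∀ c : ℕ, c < 2 * n + 1 → (c < s ∨ (n ≤ c ∧ c ≤ n + s)) → c ≠ a.val →
        ((c < a.val ∧ a.val ≤ c + n) ∨ a.val + n + 1 ≤ c) ∨
        ((c < q ∧ q ≤ c + n) ∨ q + n + 1 ≤ c)) →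
      ∃ p ∈ primeSupport n s, ∃ q ∈ primeSupport n s, p ≠ q ∧
      ∀ c ∈ primeSupport n s, c ≠ a → c ∈ windowSupport p ∨ c ∈ windowSupport q := by
    intro q hq haq hqs h
    refine ⟨a, ha, (q : ZMod (2 * n + 1)), ?_, ?_, ?_⟩
    · rwa [mem_primeSupport, ZMod.val_cast_of_lt hq]
    · intro h
      apply haq
      rw [h, ZMod.val_cast_of_lt hq]
    · intro c hc hca
      rw [mem_windowSupport, mem_windowSupport, ZMod.val_cast_of_lt hq]
      exact h c.val c.val_lt (mem_primeSupport.1 hc) fun h' => hca (ZMod.val_injective _ h')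
  rw [mem_primeSupport] at ha
  by_cases h1 : a.val < s
  · exact key (n + a.val + 1) (by omega) (by omega) (by omega) (by intro c; omega)
  by_cases h2 : a.val < n + s
  · exact key (a.val - n) (by omega) (by omega) (by omega) (by intro c; omega)
  · exact key n (by omega) (by omega) (by omega) (by intro c; omega)

/-- A monomial whose annihilator modulo the `d`-th power of the ideal of the windows is generated
by the variables indexed by `primeSupport`. -/
noncomputable def socleMonomial (K : Type*) [Field K] (n d s : ℕ) :
    MvPolynomial (ZMod (2 * n + 1)) K :=
  (∏ c ∈ primeSupport n s, X c) ^ (s - 1) * (∏ c ∈ (primeSupport n s)ᶜ, X c) ^ (2 * s - 1) *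
    window K (n : ZMod (2 * n + 1)) ^ (d - (2 * s - 1))

lemma prod_prod_eq_prod_pow_card {ν σ M : Type*} [Fintype σ] [DecidableEq σ] [CommMonoid M]
    (D : Finset ν) (W : ν → Finset σ) (x : σ → M) :
    ∏ k ∈ D, ∏ c ∈ W k, x c = ∏ c, x c ^ (D.filter fun k => c ∈ W k).card := by
  simp_rw [← Finset.prod_const, Finset.prod_filter]
  rw [Finset.prod_comm]
  refine Finset.prod_congr rfl fun k _ => ?_
  rw [← Finset.prod_filter, Finset.filter_univ_mem]

lemma mul_prod_pow_mul_prod_compl_pow {σ M : Type*} [Fintype σ] [DecidableEq σ] [CommMonoid M]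
    (A : Finset σ) (x : σ → M) (a : σ) (p q : ℕ) :
    x a * ((∏ c ∈ A, x c) ^ p * (∏ c ∈ Aᶜ, x c) ^ q) =
      ∏ c, x c ^ ((if c = a then 1 else 0) + if c ∈ A then p else q) := by
  simp_rw [pow_add]
  rw [Finset.prod_mul_distrib, ← Finset.prod_mul_prod_compl A
    (fun c => x c ^ (if c ∈ A then p else q)), ← Finset.prod_pow, ← Finset.prod_pow]
  congr 1
  · simp [pow_ite]
  · congr 1
    · exact Finset.prod_congr rfl fun c hc => by rw [if_pos hc]
    · exact Finset.prod_congr rfl fun c hc => by rw [if_neg (Finset.mem_compl.1 hc)]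

lemma X_mul_socleMonomial_mem {d s : ℕ} (hs : 1 ≤ s) (hsn : s ≤ n) (hd : 2 * s - 1 ≤ d)
    {a : ZMod (2 * n + 1)} (ha : a ∈ primeSupport n s) :
    X a * socleMonomial K n d s ∈
      Ideal.span (Set.range (window K : ZMod (2 * n + 1) → _)) ^ d := by
  obtain ⟨p, hp, q, hq, hpq, hcov⟩ := exists_pair_covering hs hsn ha
  let D := ((primeSupport n s).erase p).erase q
  have hD : D.card = 2 * s - 1 := by
    rw [Finset.card_erase_of_mem (Finset.mem_erase.2 ⟨hpq.symm, hq⟩), Finset.card_erase_of_mem hp,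
      card_primeSupport hsn]
    omega
  have hmem : ∏ k ∈ D, window K k ∈
      Ideal.span (Set.range (window K : ZMod (2 * n + 1) → _)) ^ (2 * s - 1) := by
    rw [← hD, ← Finset.prod_const]
    exact Ideal.prod_mem_prod fun k _ => Ideal.subset_span ⟨k, rfl⟩
  have hdvd : ∏ k ∈ D, window K k ∣ X a * ((∏ c ∈ primeSupport n s, X c) ^ (s - 1) *
      (∏ c ∈ (primeSupport n s)ᶜ, X c) ^ (2 * s - 1)) := by
    have h1 : ∏ k ∈ D, window K k = ∏ c, (X c : MvPolynomial (ZMod (2 * n + 1)) K) ^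
        (D.filter fun k => c ∈ windowSupport k).card := by
      rw [Finset.prod_congr rfl fun k _ => window_eq_prod_windowSupport k]
      exact prod_prod_eq_prod_pow_card D windowSupport X
    rw [h1, mul_prod_pow_mul_prod_compl_pow]
    refine Finset.prod_dvd_prod_of_dvd _ _ fun c _ => pow_dvd_pow _ ?_
    by_cases hc : c ∈ primeSupport n s
    · rw [if_pos hc]
      have h3 := card_filter_mem_windowSupport_le hc
      have hsub : (D.filter fun k => c ∈ windowSupport k) ⊆
          (primeSupport n s).filter fun k => c ∈ windowSupport k :=
        Finset.filter_subset_filter _ ((Finset.erase_subset _ _).trans (Finset.erase_subset _ _))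
      by_cases hca : c = a
      · rw [if_pos hca]
        have := Finset.card_le_card hsub
        omega
      · rw [if_neg hca]
        have : (D.filter fun k => c ∈ windowSupport k).card <
            ((primeSupport n s).filter fun k => c ∈ windowSupport k).card := by
          refine Finset.card_lt_card (hsub.ssubset_of_ne fun h => ?_)
          rcases hcov c hc hca with h4 | h4
          · have : p ∈ D.filter fun k => c ∈ windowSupport k :=
              h ▸ Finset.mem_filter.2 ⟨hp, h4⟩
            simp [D] at this
          · have : q ∈ D.filter fun k => c ∈ windowSupport k :=
              h ▸ Finset.mem_filter.2 ⟨hq, h4⟩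
            simp [D] at this
        omega
    · rw [if_neg hc]
      have := Finset.card_filter_le D fun k => c ∈ windowSupport k
      omega
  have hpow : Ideal.span (Set.range (window K : ZMod (2 * n + 1) → _)) ^ d =
      Ideal.span (Set.range (window K)) ^ (2 * s - 1) *
        Ideal.span (Set.range (window K)) ^ (d - (2 * s - 1)) := by
    rw [← pow_add, Nat.add_sub_cancel' hd]
  rw [socleMonomial, ← mul_assoc, hpow]
  exact Ideal.mul_mem_mul (Ideal.mem_of_dvd _ hdvd hmem)
    (Ideal.pow_mem_pow (Ideal.subset_span (Set.mem_range_self (n : ZMod (2 * n + 1)))) _)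

/-- The substitution multiplying the variables in `A` by a new variable. -/
noncomputable def weightMap {σ : Type*} [DecidableEq σ] (K : Type*) [Field K] (A : Finset σ) :
    MvPolynomial σ K →ₐ[K] Polynomial (MvPolynomial σ K) :=
  aeval fun c => if c ∈ A then Polynomial.C (X c) * Polynomial.X else Polynomial.C (X c)

lemma weightMap_prod_X {σ : Type*} [DecidableEq σ] (A W : Finset σ) :
    weightMap K A (∏ c ∈ W, X c) =
      Polynomial.C (∏ c ∈ W, X c) * Polynomial.X ^ (W ∩ A).card := by
  rw [map_prod, map_prod, ← Finset.filter_mem_eq_inter, ← Finset.prod_const, Finset.prod_filter,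
    ← Finset.prod_mul_distrib]
  refine Finset.prod_congr rfl fun c _ => ?_
  simp only [weightMap, aeval_X]
  split_ifs <;> simp

lemma coeff_zero_weightMap {σ : Type*} [DecidableEq σ] (A : Finset σ) (f : MvPolynomial σ K) :
    (weightMap K A f).coeff 0 = killVars K A f := by
  have : (Polynomial.constantCoeff : Polynomial (MvPolynomial σ K) →+* _).comp
      (weightMap K A : MvPolynomial σ K →+* Polynomial (MvPolynomial σ K)) =
      (killVars K A : MvPolynomial σ K →+* MvPolynomial σ K) := by
    ext i m
    · simp [weightMap, killVars, algebraMap_eq]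
    · by_cases h : i ∈ A <;> simp [weightMap, killVars, h]
  exact RingHom.congr_fun this f

lemma mem_span_of_X_pow_dvd_weightMap {σ : Type*} [DecidableEq σ] {A : Finset σ} {N : ℕ}
    {u f : MvPolynomial σ K} (hu0 : u ≠ 0)
    (hu : weightMap K A u = Polynomial.C u * Polynomial.X ^ N)
    (h : Polynomial.X ^ (N + 1) ∣ weightMap K A (u * f)) : f ∈ Ideal.span (X '' (A : Set σ)) := by
  rw [map_mul, hu, pow_succ, mul_right_comm, mul_comm _ (Polynomial.X ^ _)] at h
  have h3 := Polynomial.X_dvd_iff.1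
    ((mul_dvd_mul_iff_left (pow_ne_zero _ Polynomial.X_ne_zero)).1 h)
  rw [Polynomial.mul_coeff_zero, Polynomial.coeff_C_zero, coeff_zero_weightMap] at h3
  exact killVars_eq_zero_iff.1 ((mul_eq_zero.1 h3).resolve_left hu0)

lemma X_pow_dvd_weightMap_of_mem_pow {σ ι : Type*} [DecidableEq σ] {A : Finset σ}
    {W : ι → Finset σ} {s : ℕ} (hW : ∀ k, s ≤ (W k ∩ A).card) (d : ℕ) {f : MvPolynomial σ K}
    (hf : f ∈ Ideal.span (Set.range fun k => ∏ c ∈ W k, X c) ^ d) :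
    Polynomial.X ^ (s * d) ∣ weightMap K A f := by
  have h1 : Ideal.span (Set.range fun k => ∏ c ∈ W k, (X c : MvPolynomial σ K)) ^ d ≤
      (Ideal.span {Polynomial.X ^ (s * d)}).comap (weightMap K A) := by
    rw [← Ideal.map_le_iff_le_comap, Ideal.map_pow, pow_mul, ← Ideal.span_singleton_pow]
    refine Ideal.pow_right_mono ?_ d
    rw [Ideal.map_span, Ideal.span_le]
    rintro _ ⟨_, ⟨k, rfl⟩, rfl⟩
    rw [SetLike.mem_coe, Ideal.mem_span_singleton]
    simp only [weightMap_prod_X]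
    exact Dvd.dvd.mul_left (pow_dvd_pow _ (hW k)) _
  exact Ideal.mem_span_singleton.1 (h1 hf)

lemma weightMap_monomial_eq {σ : Type*} [Fintype σ] [DecidableEq σ] (A W : Finset σ)
    (p q r : ℕ) :
    weightMap K A ((∏ c ∈ A, X c) ^ p * (∏ c ∈ Aᶜ, X c) ^ q * (∏ c ∈ W, X c) ^ r) =
      Polynomial.C ((∏ c ∈ A, X c) ^ p * (∏ c ∈ Aᶜ, X c) ^ q * (∏ c ∈ W, X c) ^ r) *
        Polynomial.X ^ (A.card * p + (W ∩ A).card * r) := by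
  have h : Aᶜ ∩ A = ∅ := by rw [Finset.inter_comm, Finset.inter_compl]
  simp only [map_mul, map_pow, weightMap_prod_X, Finset.inter_self, h, Finset.card_empty]
  ring

lemma socleMonomial_eq (d s : ℕ) : socleMonomial K n d s =
    (∏ c ∈ primeSupport n s, X c) ^ (s - 1) * (∏ c ∈ (primeSupport n s)ᶜ, X c) ^ (2 * s - 1) *
      (∏ c ∈ windowSupport (n : ZMod (2 * n + 1)), X c) ^ (d - (2 * s - 1)) := by
  rw [socleMonomial, window_eq_prod_windowSupport]

lemma socleMonomial_ne_zero (d s : ℕ) : socleMonomial K n d s ≠ 0 := by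
  have hprod : ∀ W : Finset (ZMod (2 * n + 1)),
      (∏ c ∈ W, X c : MvPolynomial (ZMod (2 * n + 1)) K) ≠ 0 := fun W =>
    Finset.prod_ne_zero_iff.2 fun c _ => X_ne_zero c
  rw [socleMonomial_eq]
  exact mul_ne_zero (mul_ne_zero (pow_ne_zero _ (hprod _)) (pow_ne_zero _ (hprod _)))
    (pow_ne_zero _ (hprod _))

lemma weightMap_socleMonomial {d s : ℕ} (hsn : s ≤ n) :
    weightMap K (primeSupport n s) (socleMonomial K n d s) =
      Polynomial.C (socleMonomial K n d s) *
        Polynomial.X ^ ((2 * s + 1) * (s - 1) + s * (d - (2 * s - 1))) := by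
  rw [socleMonomial_eq, weightMap_monomial_eq, card_primeSupport hsn,
    le_antisymm card_windowSupport_inter_le (le_card_windowSupport_inter hsn _)]

lemma mem_of_socleMonomial_mul_mem {d s : ℕ} (hs : 1 ≤ s) (hsn : s ≤ n) (hd : 2 * s - 1 ≤ d)
    {f : MvPolynomial (ZMod (2 * n + 1)) K}
    (hf : socleMonomial K n d s * f ∈
      Ideal.span (Set.range (window K : ZMod (2 * n + 1) → _)) ^ d) :
    f ∈ Ideal.span (X '' (primeSupport n s : Set (ZMod (2 * n + 1)))) := by
  have he : s * d = (2 * s + 1) * (s - 1) + s * (d - (2 * s - 1)) + 1 := by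
    obtain ⟨t, rfl⟩ := Nat.exists_eq_add_of_le' hs
    obtain ⟨r, rfl⟩ := Nat.exists_eq_add_of_le' hd
    rw [Nat.add_sub_cancel, Nat.add_sub_cancel, show 2 * (t + 1) - 1 = 2 * t + 1 by omega]
    ring
  rw [show (window K : ZMod (2 * n + 1) → _) = fun k => ∏ c ∈ windowSupport k, X c from
    funext window_eq_prod_windowSupport] at hf
  refine mem_span_of_X_pow_dvd_weightMap (socleMonomial_ne_zero d s)
    (weightMap_socleMonomial hsn) ?_
  rw [← he]
  exact X_pow_dvd_weightMap_of_mem_pow (le_card_windowSupport_inter hsn) d hf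

lemma mem_span_iff_socleMonomial_mul_mem {d s : ℕ} (hs : 1 ≤ s) (hsn : s ≤ n)
    (hd : 2 * s - 1 ≤ d) {f : MvPolynomial (ZMod (2 * n + 1)) K} :
    f ∈ Ideal.span (X '' (primeSupport n s : Set (ZMod (2 * n + 1)))) ↔
      socleMonomial K n d s * f ∈
        Ideal.span (Set.range (window K : ZMod (2 * n + 1) → _)) ^ d := by
  refine ⟨fun h => ?_, mem_of_socleMonomial_mul_mem hs hsn hd⟩
  have : Ideal.span (X '' (primeSupport n s : Set (ZMod (2 * n + 1)))) ≤
      (Ideal.span (Set.range (window K : ZMod (2 * n + 1) → _)) ^ d).colon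
        {socleMonomial K n d s} := by
    rw [Ideal.span_le]
    rintro _ ⟨a, ha, rfl⟩
    rw [SetLike.mem_coe, Submodule.mem_colon_singleton]
    exact X_mul_socleMonomial_mem hs hsn hd ha
  have h1 := Submodule.mem_colon_singleton.1 (this h)
  rwa [smul_eq_mul, mul_comm f] at h1

end AssociatedPrime

section Transfer

variable {n : ℕ} {E K : Type} [Field K]

namespace ToricSpecialization

variable {P : ZMod (2 * n + 1) → MvPolynomial E K} {Y : Finset E} (T : ToricSpecialization P Y)

lemma π_ι_apply (f : MvPolynomial (ZMod (2 * n + 1)) K) : T.π (T.ι f) = f := by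
  have : T.π.comp T.ι = AlgHom.id K _ := by
    ext k : 1
    simp [T.π_ι]
  exact AlgHom.congr_fun this f

lemma sub_ι_π_mem (f : MvPolynomial E K) :
    f - T.ι (T.π f) ∈ Ideal.span (X '' (Y : Set E)) := by
  refine sub_mem_of_X_sub_mem (T.ι.comp T.π) _ (fun x => ?_) f
  by_cases hx : x ∈ Y
  · rw [AlgHom.comp_apply, T.π_X x hx, map_zero, sub_zero]
    exact Ideal.subset_span ⟨x, hx, rfl⟩
  · rw [AlgHom.comp_apply, T.ι_π x hx, sub_self]
    exact Ideal.zero_mem _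

lemma span_X_le_ker : Ideal.span (X '' (Y : Set E)) ≤ RingHom.ker T.π := by
  rw [Ideal.span_le]
  rintro _ ⟨x, hx, rfl⟩
  exact T.π_X x hx

lemma mem_sup_span_iff {J : Ideal (MvPolynomial E K)} {f : MvPolynomial E K} :
    f ∈ J ⊔ Ideal.span (X '' (Y : Set E)) ↔ T.π f ∈ J.map T.π := by
  constructor
  · intro h
    obtain ⟨a, ha, b, hb, rfl⟩ := Submodule.mem_sup.1 h
    rw [map_add, RingHom.mem_ker.1 (T.span_X_le_ker hb), add_zero]
    exact Ideal.mem_map_of_mem _ ha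
  · intro h
    obtain ⟨a, ha, hab⟩ := (Ideal.mem_map_iff_of_surjective T.π
      fun g => ⟨T.ι g, T.π_ι_apply g⟩).1 h
    have h1 := T.sub_ι_π_mem f
    have h2 := T.sub_ι_π_mem a
    rw [hab] at h2
    have : f = a + ((f - T.ι (T.π f)) - (a - T.ι (T.π f))) := by ring
    rw [this]
    exact Submodule.add_mem_sup ha (Ideal.sub_mem _ h1 h2)

lemma map_span_pow (d : ℕ) : (Ideal.span (Set.range P) ^ d).map T.π =
    Ideal.span (Set.range (window K : ZMod (2 * n + 1) → _)) ^ d := by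
  rw [Ideal.map_pow, Ideal.map_span, ← Set.range_comp]
  congr 3
  exact funext T.π_P

lemma π_X_e (k : ZMod (2 * n + 1)) : T.π (X (T.e k)) = C (T.ε k)⁻¹ * X k := by
  have h := T.π_ι k
  rw [T.ι_X, map_mul, ← algebraMap_eq, AlgHom.commutes, algebraMap_eq] at h
  rw [← h, ← mul_assoc, ← C_mul, inv_mul_cancel₀ (T.ε_ne_zero k), C_1, one_mul]

lemma span_pow_ne_bot (T : ToricSpecialization P Y) (d : ℕ) : Ideal.span (Set.range P) ^ d ≠ ⊥ := by
  refine pow_ne_zero d fun h => ?_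
  have h1 : P 0 ∈ Ideal.span (Set.range P) := Ideal.subset_span ⟨0, rfl⟩
  rw [h] at h1
  have h2 := T.π_P 0
  rw [(Submodule.mem_bot _).1 h1, map_zero] at h2
  exact window_ne_zero (K := K) (0 : ZMod (2 * n + 1)) h2.symm

variable [DecidableEq E]

lemma span_X_union_eq (A : Finset (ZMod (2 * n + 1))) :
    Ideal.span (X '' ((Y ∪ A.image T.e : Finset E) : Set E)) =
      Ideal.span ((fun k => X (T.e k)) '' (A : Set (ZMod (2 * n + 1)))) ⊔
        Ideal.span (X '' (Y : Set E) : Set (MvPolynomial E K)) := by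
  rw [Finset.coe_union, Set.image_union, Ideal.span_union, Finset.coe_image, Set.image_image,
    sup_comm]

lemma mem_span_X_union_iff (A : Finset (ZMod (2 * n + 1))) {f : MvPolynomial E K} :
    f ∈ Ideal.span (X '' ((Y ∪ A.image T.e : Finset E) : Set E)) ↔
      T.π f ∈ Ideal.span (X '' (A : Set (ZMod (2 * n + 1)))) := by
  rw [span_X_union_eq, T.mem_sup_span_iff]
  suffices h : (Ideal.span ((fun k => X (T.e k)) '' (A : Set (ZMod (2 * n + 1))))).map T.π =
      Ideal.span (X '' (A : Set (ZMod (2 * n + 1)))) by rw [h]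
  rw [Ideal.map_span]
  refine le_antisymm (Ideal.span_le.2 ?_) (Ideal.span_le.2 ?_)
  · rintro _ ⟨_, ⟨k, hk, rfl⟩, rfl⟩
    simp only [T.π_X_e]
    exact Ideal.mul_mem_left _ _ (Ideal.subset_span ⟨k, hk, rfl⟩)
  · rintro _ ⟨k, hk, rfl⟩
    have h : (X k : MvPolynomial _ K) = C (T.ε k) * T.π (X (T.e k)) := by
      rw [π_X_e, ← mul_assoc, ← C_mul, mul_inv_cancel₀ (T.ε_ne_zero k), C_1, one_mul]
    rw [h]
    exact Ideal.mul_mem_left _ _ (Ideal.subset_span ⟨_, ⟨k, hk, rfl⟩, rfl⟩)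

lemma isPrime_span_X (F : Finset E) :
    (Ideal.span (X '' (F : Set E)) : Ideal (MvPolynomial E K)).IsPrime := by
  have : Ideal.span (X '' (F : Set E)) = RingHom.ker (killVars K F) := by
    ext f
    rw [← killVars_eq_zero_iff, RingHom.mem_ker]
  rw [this]
  exact RingHom.ker_isPrime _

theorem exists_not_extVanishesAt (T : ToricSpecialization P Y) [Finite E] {d s : ℕ}
    (hs : 1 ≤ s) (hsn : s ≤ n)
    (hd : 2 * s - 1 ≤ d) : ∃ p : PrimeSpectrum (MvPolynomial E K),
      ¬ ExtVanishesAt p (Ideal.span (Set.range P) ^ d) (2 * s + 1) := by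
  classical
  let F := Y ∪ (primeSupport n s).image T.e
  refine ⟨⟨Ideal.span (X '' (F : Set E)), isPrime_span_X F⟩, ?_⟩
  refine not_extVanishesAt (V := F.image X) (Y := Y.image X)
    (u := T.ι (socleMonomial K n d s)) (isPermutableRegular_bot_image_X F) ?_
    (T.isPermutableRegular d) (Finset.image_subset_image Finset.subset_union_left) (fun f => ?_) ?_
  · rw [Finset.coe_image]
  · rw [Finset.coe_image, T.mem_sup_span_iff, T.map_span_pow, map_mul, T.π_ι_apply,
      ← mem_span_iff_socleMonomial_mul_mem hs hsn hd]
    exact T.mem_span_X_union_iff _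
  · rw [Finset.card_image_of_injective _ (X_injective),
      Finset.card_image_of_injective _ X_injective,
      Finset.card_union_of_disjoint, Finset.card_image_of_injective _ T.e_injective,
      card_primeSupport hsn]
    rw [Finset.disjoint_right]
    intro x hx
    obtain ⟨k, -, rfl⟩ := Finset.mem_image.1 hx
    exact T.e_notMem k

end ToricSpecialization

end Transfer

section CycleMatrix

variable {n : ℕ}

/-- The skew-symmetric matrix supported on the edges of a cycle of length `2n + 1`. -/
def cycleMatrix {R : Type*} [CommRing R] (z : ZMod (2 * n + 1) → R) :
    Matrix (ZMod (2 * n + 1)) (ZMod (2 * n + 1)) R := fun i j =>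
  (if j = i + 1 then z i else 0) - if i = j + 1 then z j else 0

lemma cycleMatrix_swap {R : Type*} [CommRing R] (z : ZMod (2 * n + 1) → R)
    (i j : ZMod (2 * n + 1)) : cycleMatrix z j i = -cycleMatrix z i j := by
  simp [cycleMatrix]

lemma cycleMatrix_self {R : Type*} [CommRing R] (z : ZMod (2 * n + 1) → R)
    (i : ZMod (2 * n + 1)) : cycleMatrix z i i = 0 := by
  simp [cycleMatrix]

lemma add_natCast_self_add_one : (n + n + 1 : ZMod (2 * n + 1)) = 0 := by
  have := ZMod.natCast_self (2 * n + 1)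
  push_cast at this
  rw [← this]; ring

/-- Multiplication by two on `ZMod (2n + 1)`. -/
def doubleEquiv (n : ℕ) : ZMod (2 * n + 1) ≃ ZMod (2 * n + 1) where
  toFun k := k + k
  invFun i := (n + 1) * i
  left_inv k := by linear_combination k * add_natCast_self_add_one (n := n)
  right_inv i := by linear_combination i * add_natCast_self_add_one (n := n)

lemma doubleEquiv_symm_add_one (i : ZMod (2 * n + 1)) :
    (doubleEquiv n).symm (i + 1) = (doubleEquiv n).symm i - n := by
  change ((n : ZMod (2 * n + 1)) + 1) * (i + 1) = (n + 1) * i - n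
  linear_combination add_natCast_self_add_one (n := n)

lemma doubleEquiv_add_one (k : ZMod (2 * n + 1)) :
    doubleEquiv n (k + 1) = doubleEquiv n k + 1 + 1 := by
  change k + 1 + (k + 1) = k + k + 1 + 1
  ring

lemma cycleMatrix_doubleEquiv_add_one_row {R : Type*} [CommRing R] (z : ZMod (2 * n + 1) → R)
    (k j : ZMod (2 * n + 1)) :
    cycleMatrix z (doubleEquiv n k + 1) (doubleEquiv n j) =
      (if j = k + 1 then z (doubleEquiv n k + 1) else 0) -
        if j = k then z (doubleEquiv n k) else 0 := by
  have h1 : doubleEquiv n j = doubleEquiv n k + 1 + 1 ↔ j = k + 1 := by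
    rw [← doubleEquiv_add_one, (doubleEquiv n).apply_eq_iff_eq]
  have h2 : doubleEquiv n k + 1 = doubleEquiv n j + 1 ↔ j = k := by
    rw [add_left_inj, (doubleEquiv n).apply_eq_iff_eq, eq_comm]
  simp only [cycleMatrix, h1, h2]
  congr 1
  split_ifs with h
  · rw [h]
  · rfl

variable (K : Type*) [Field K]

/-- The generic matrix supported on the edges of a cycle, with suitably labelled variables. -/
noncomputable def genericCycle (n : ℕ) : Matrix (ZMod (2 * n + 1)) (ZMod (2 * n + 1))
    (MvPolynomial (ZMod (2 * n + 1)) K) := cycleMatrix fun i => X ((doubleEquiv n).symm i)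

/-- The signed sub-maximal Pfaffian of `genericCycle` at the vertex `2k`. -/
noncomputable def cyclePfaffian (k : ZMod (2 * n + 1)) : MvPolynomial (ZMod (2 * n + 1)) K :=
  subPfaffian (genericCycle K n) (doubleEquiv n k)

variable {K}

lemma cyclePfaffian_eq (k : ZMod (2 * n + 1)) : cyclePfaffian K k =
    (-1) ^ (doubleEquiv n k : Fin (2 * n + 1)).val *
      pfaffianSum (Matrix.submatrix (genericCycle K n)
        (Fin.succAbove (doubleEquiv n k : Fin (2 * n + 1)))
        (Fin.succAbove (doubleEquiv n k : Fin (2 * n + 1)))) := rfl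

lemma genericCycle_row (k j : ZMod (2 * n + 1)) :
    genericCycle K n (doubleEquiv n k + 1) (doubleEquiv n j) =
      (if j = k + 1 then X (k - n) else 0) - if j = k then X k else 0 := by
  rw [genericCycle, cycleMatrix_doubleEquiv_add_one_row, doubleEquiv_symm_add_one,
    Equiv.symm_apply_apply]

lemma X_mul_cyclePfaffian (k : ZMod (2 * n + 1)) :
    X k * cyclePfaffian K k = X (k - n) * cyclePfaffian K (k + 1) := by
  have h := sum_mul_subPfaffian (genericCycle K n) (cycleMatrix_swap _) (cycleMatrix_self _)
    (doubleEquiv n k + 1 : ZMod (2 * n + 1))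
  have h1 : ∑ j, genericCycle K n (doubleEquiv n k + 1) (doubleEquiv n j) * cyclePfaffian K j = 0 :=
    ((doubleEquiv n).sum_comp fun i => genericCycle K n (doubleEquiv n k + 1) i *
      subPfaffian (genericCycle K n) i).trans h
  simp only [genericCycle_row, sub_mul, ite_mul, zero_mul, Finset.sum_sub_distrib,
    Finset.sum_ite_eq', Finset.mem_univ, if_true] at h1
  exact (sub_eq_zero.1 h1).symm

lemma X_mul_window (k : ZMod (2 * n + 1)) :
    X k * window K k = X (k - n) * window K (k + 1) := by
  have h1 : window K (k + 1) = ∏ i ∈ Finset.range n, X (k - (i : ℕ)) := by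
    refine Finset.prod_congr rfl fun i _ => ?_
    congr 1
    push_cast
    ring
  have h2 := Finset.prod_range_succ (fun i : ℕ => (X (k - (i : ZMod (2 * n + 1))) :
    MvPolynomial (ZMod (2 * n + 1)) K)) n
  rw [Finset.prod_range_succ', Nat.cast_zero, sub_zero] at h2
  rw [h1, window]
  linear_combination h2

lemma cyclePfaffian_mul_window (k : ZMod (2 * n + 1)) :
    cyclePfaffian K k * window K 0 = cyclePfaffian K 0 * window K k := by
  suffices h : ∀ m : ℕ, cyclePfaffian K (m : ZMod (2 * n + 1)) * window K 0 =
      cyclePfaffian K 0 * window K (m : ZMod (2 * n + 1)) by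
    have := h k.val
    rwa [ZMod.natCast_zmod_val] at this
  intro m
  induction m with
  | zero => simp
  | succ m ih =>
    rw [Nat.cast_succ]
    apply mul_left_cancel₀ (mul_ne_zero (X_ne_zero ((m : ZMod (2 * n + 1)) - n))
      (window_ne_zero (K := K) (m : ZMod (2 * n + 1))))
    have h1 := X_mul_cyclePfaffian (K := K) (m : ZMod (2 * n + 1))
    have h2 := X_mul_window (K := K) (m : ZMod (2 * n + 1))
    linear_combination (-window K (m : ZMod (2 * n + 1)) * window K 0) * h1 +
      X (m : ZMod (2 * n + 1)) * window K (m : ZMod (2 * n + 1)) * ih +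
      cyclePfaffian K 0 * window K (m : ZMod (2 * n + 1)) * h2

lemma X_dvd_prod_X_iff {σ : Type*} {W : Finset σ} {c : σ} :
    (X c : MvPolynomial σ K) ∣ ∏ i ∈ W, X i ↔ c ∈ W := by
  rw [X_prime.dvd_finsetProd_iff]
  simp [X_dvd_X]

lemma window_dvd_cyclePfaffian : window K 0 ∣ cyclePfaffian K (0 : ZMod (2 * n + 1)) := by
  rw [window_eq_prod_windowSupport]
  refine Finset.prod_dvd_of_isRelPrime (fun a _ b _ hab => ?_) fun c hc => ?_
  · refine (X_prime.irreducible.isRelPrime_iff_not_dvd).2 fun h => hab ?_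
    simpa [X_dvd_X] using h
  · have h : X c ∣ cyclePfaffian K 0 * window K c := by
      rw [← cyclePfaffian_mul_window, window_eq_prod_windowSupport 0]
      exact (X_dvd_prod_X_iff.2 hc).mul_left _
    refine (X_prime.dvd_or_dvd h).resolve_right fun h' => ?_
    rw [window_eq_prod_windowSupport, X_dvd_prod_X_iff, mem_windowSupport] at h'
    omega

lemma totalDegree_genericCycle_le (i j : ZMod (2 * n + 1)) :
    (genericCycle K n i j).totalDegree ≤ 1 := by
  refine (totalDegree_sub _ _).trans (max_le ?_ ?_) <;>
  · split_ifs <;> simp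

lemma totalDegree_pfaffianSum_le {σ : Type*}
    {A : Matrix (Fin (2 * n)) (Fin (2 * n)) (MvPolynomial σ K)}
    (hA : ∀ i j, (A i j).totalDegree ≤ 1) : (pfaffianSum A).totalDegree ≤ n := by
  refine totalDegree_finsetSum_le fun τ _ => ?_
  have h : (∏ i : Fin n, A (τ ⟨2 * (i : ℕ), two_mul_val_lt i⟩)
      (τ ⟨2 * (i : ℕ) + 1, two_mul_val_add_one_lt i⟩)).totalDegree ≤ n :=
    (totalDegree_finsetProd _ _).trans
      ((Finset.sum_le_sum fun i _ => hA _ _).trans (by simp))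
  rcases Int.units_eq_one_or (Equiv.Perm.sign τ) with hτ | hτ <;> simpa [hτ] using h

lemma totalDegree_window (k : ZMod (2 * n + 1)) : (window K k).totalDegree = n := by
  have := IsHomogeneous.prod (Finset.range n)
    (fun i : ℕ => (X (k - (i + 1 : ℕ)) : MvPolynomial (ZMod (2 * n + 1)) K)) (fun _ => 1)
    fun i _ => isHomogeneous_X K _
  rw [Finset.sum_const, Finset.card_range, smul_eq_mul, mul_one] at this
  exact this.totalDegree (window_ne_zero k)

lemma cyclePfaffian_ne_zero [CharZero K] : cyclePfaffian K (n : ZMod (2 * n + 1)) ≠ 0 := by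
  have hlast : doubleEquiv n (n : ZMod (2 * n + 1)) = Fin.last (2 * n) := by
    apply ZMod.val_injective
    change ((n : ZMod (2 * n + 1)) + n).val = 2 * n
    rw [← Nat.cast_add, ZMod.val_cast_of_lt (by omega)]
    omega
  let g : ZMod (2 * n + 1) → K := fun i => if i.val % 2 = 0 ∧ i.val ≠ 2 * n then 1 else 0
  let f : MvPolynomial (ZMod (2 * n + 1)) K →+* K :=
    (aeval fun k => g (doubleEquiv n k) : MvPolynomial (ZMod (2 * n + 1)) K →ₐ[K] K)
  have hf : ∀ i j, f (genericCycle K n i j) = cycleMatrix g i j := by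
    intro i j
    rw [genericCycle, cycleMatrix, cycleMatrix, map_sub, apply_ite f, apply_ite f]
    simp [f]
  intro h0
  have h1 := congrArg f ((cyclePfaffian_eq _).symm.trans h0)
  rw [map_zero, map_mul, map_pfaffianSum, mul_eq_zero] at h1
  refine h1.elim ?_ (pfaffianSum_ne_zero _ ?_)
  · simp
  intro p q
  have hcast : ∀ p : Fin n × Fin 2, ((doubleEquiv n (n : ZMod (2 * n + 1)) :
      Fin (2 * n + 1)).succAbove (pairEquiv n p) : Fin (2 * n + 1)) =
      ((2 * (p.1 : ℕ) + p.2 : ℕ) : ZMod (2 * n + 1)) := by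
    intro p
    rw [hlast, Fin.succAbove_last]
    apply ZMod.val_injective (2 * n + 1)
    rw [ZMod.val_cast_of_lt (by omega)]
    rfl
  refine (hf _ _).trans ((congrArg₂ (cycleMatrix g) (hcast p) (hcast q)).trans ?_)
  obtain ⟨i, a⟩ := p
  obtain ⟨j, b⟩ := q
  have hsucc : ∀ x y : ℕ, x < 2 * n → y < 2 * n →
      ((y : ZMod (2 * n + 1)) = (x : ZMod (2 * n + 1)) + 1 ↔ y = x + 1) := by
    intro x y hx hy
    rw [← Nat.cast_succ]
    refine ⟨fun h => ?_, fun h => by rw [h]⟩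
    have := congrArg ZMod.val h
    rwa [ZMod.val_cast_of_lt (by omega), ZMod.val_cast_of_lt (by omega)] at this
  simp only [cycleMatrix, hsucc (2 * i + a) (2 * j + b) (by omega) (by omega),
    hsucc (2 * j + b) (2 * i + a) (by omega) (by omega), g]
  rw [ZMod.val_cast_of_lt (by omega), ZMod.val_cast_of_lt (by omega)]
  by_cases hij : i = j
  · subst hij
    fin_cases a <;> fin_cases b <;> simp <;> omega
  · have hij' : (i : ℕ) ≠ j := fun h => hij (Fin.ext h)
    rw [if_neg hij]
    fin_cases a <;> fin_cases b <;> simp <;> grind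

/-- The sub-maximal Pfaffians of the generic cycle matrix are the windows, up to a common scalar. -/
theorem exists_cyclePfaffian_eq [CharZero K] (n : ℕ) : ∃ a : K, a ≠ 0 ∧
    ∀ k : ZMod (2 * n + 1), cyclePfaffian K k = C a * window K k := by
  have h0 : cyclePfaffian K (0 : ZMod (2 * n + 1)) ≠ 0 := by
    intro h
    have := cyclePfaffian_mul_window (K := K) (n : ZMod (2 * n + 1))
    rw [h, zero_mul] at this
    exact (mul_ne_zero cyclePfaffian_ne_zero (window_ne_zero _)) this
  obtain ⟨f, hf⟩ := window_dvd_cyclePfaffian (K := K) (n := n)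
  have hf0 : f ≠ 0 := by
    rintro rfl
    exact h0 (by rw [hf, mul_zero])
  have hdeg : (cyclePfaffian K (0 : ZMod (2 * n + 1))).totalDegree ≤ n := by
    rw [cyclePfaffian_eq]
    refine (totalDegree_mul _ _).trans ?_
    have h2 : ∀ m : ℕ, ((-1 : MvPolynomial (ZMod (2 * n + 1)) K) ^ m).totalDegree = 0 := by
      intro m
      rcases neg_one_pow_eq_or (MvPolynomial (ZMod (2 * n + 1)) K) m with h | h <;> simp [h]
    rw [h2, zero_add]
    exact totalDegree_pfaffianSum_le fun i j => totalDegree_genericCycle_le _ _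
  rw [hf, totalDegree_mul_of_isDomain (window_ne_zero _) hf0, totalDegree_window] at hdeg
  obtain ⟨a, rfl⟩ : ∃ a, f = C a := ⟨_, totalDegree_eq_zero_iff_eq_C.1 (by omega)⟩
  refine ⟨a, fun h => hf0 (by rw [h, C_0]), fun k => ?_⟩
  apply mul_right_cancel₀ (window_ne_zero (K := K) (0 : ZMod (2 * n + 1)))
  rw [cyclePfaffian_mul_window, hf]
  ring

end CycleMatrix

section GenericSkew

variable {n : ℕ} (K : Type*) [Field K]

/-- The generic skew-symmetric matrix of size `2n + 1`. -/
noncomputable def genericSkew (n : ℕ) : Matrix (Fin (2 * n + 1)) (Fin (2 * n + 1))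
    (MvPolynomial {p : Fin (2 * n + 1) × Fin (2 * n + 1) // p.1 < p.2} K) := fun i j =>
  if h : i < j then X ⟨(i, j), h⟩ else if h : j < i then -X ⟨(j, i), h⟩ else 0

/-- The specialization of `genericSkew` to `genericCycle`. -/
noncomputable def toCycle (n : ℕ) :
    MvPolynomial {p : Fin (2 * n + 1) × Fin (2 * n + 1) // p.1 < p.2} K →ₐ[K]
      MvPolynomial (ZMod (2 * n + 1)) K :=
  aeval fun x => genericCycle K n x.1.1 x.1.2

/-- The section of `toCycle` given by the entries of `genericSkew` on the edges of the cycle. -/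
noncomputable def ofCycle (n : ℕ) : MvPolynomial (ZMod (2 * n + 1)) K →ₐ[K]
    MvPolynomial {p : Fin (2 * n + 1) × Fin (2 * n + 1) // p.1 < p.2} K :=
  aeval fun k => genericSkew K n (doubleEquiv n k) (doubleEquiv n k + 1 : ZMod (2 * n + 1))

variable {K}

lemma genericSkew_of_lt {i j : Fin (2 * n + 1)} (h : i < j) :
    genericSkew K n i j = X ⟨(i, j), h⟩ := dif_pos h

lemma genericSkew_swap (i j : Fin (2 * n + 1)) : genericSkew K n j i = -genericSkew K n i j := by
  rcases lt_trichotomy i j with h | rfl | h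
  · simp [genericSkew, h, h.not_gt]
  · simp [genericSkew]
  · simp [genericSkew, h, h.not_gt]

lemma genericSkew_self (i : Fin (2 * n + 1)) : genericSkew K n i i = 0 := by
  simp [genericSkew]

lemma genericSkew_isHomogeneous (i j : Fin (2 * n + 1)) :
    (genericSkew K n i j).IsHomogeneous 1 := by
  rw [genericSkew]
  split_ifs
  · exact isHomogeneous_X K _
  · exact (isHomogeneous_X K _).neg
  · exact isHomogeneous_zero _ _ _

lemma exists_genericSkew_eq {i j : Fin (2 * n + 1)} (h : i ≠ j) :
    ∃ e, ∃ ε : K, ε ≠ 0 ∧ genericSkew K n i j = C ε * X e := by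
  rcases lt_or_gt_of_ne h with h | h
  · exact ⟨⟨(i, j), h⟩, 1, one_ne_zero, by simp [genericSkew, h]⟩
  · exact ⟨⟨(j, i), h⟩, -1, neg_ne_zero.2 one_ne_zero, by simp [genericSkew, h, h.not_gt]⟩

lemma toCycle_genericSkew (i j : Fin (2 * n + 1)) :
    toCycle K n (genericSkew K n i j) = genericCycle K n i j := by
  rcases lt_trichotomy i j with h | rfl | h
  · rw [genericSkew_of_lt h, toCycle, aeval_X]
  · rw [genericSkew_self, map_zero]
    exact (cycleMatrix_self _ _).symm
  · rw [genericSkew_swap, genericSkew_of_lt h, toCycle, map_neg, aeval_X]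
    exact (cycleMatrix_swap _ _ _).symm

lemma toCycle_subPfaffian (v : Fin (2 * n + 1)) :
    toCycle K n (subPfaffian (genericSkew K n) v) = subPfaffian (genericCycle K n) v := by
  have h := map_pfaffianSum (toCycle K n).toRingHom
    ((genericSkew K n).submatrix v.succAbove v.succAbove)
  have h2 : ((genericSkew K n).submatrix v.succAbove v.succAbove).map (toCycle K n).toRingHom =
      (genericCycle K n).submatrix v.succAbove v.succAbove :=
    Matrix.ext fun i j => toCycle_genericSkew _ _
  rw [h2] at h
  rw [subPfaffian, map_mul, map_pow, map_neg, map_one]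
  exact congrArg _ h

lemma add_one_add_one_ne (hn : 1 ≤ n) (i : ZMod (2 * n + 1)) : i + 1 + 1 ≠ i := by
  intro h
  have h2 : ((2 : ℕ) : ZMod (2 * n + 1)) = 0 := by
    push_cast
    linear_combination h
  have := Nat.le_of_dvd two_pos ((ZMod.natCast_eq_zero_iff _ _).1 h2)
  omega

lemma genericCycle_add_one (hn : 1 ≤ n) (i : ZMod (2 * n + 1)) :
    genericCycle K n i (i + 1) = X ((doubleEquiv n).symm i) := by
  rw [genericCycle, cycleMatrix, if_pos rfl, if_neg (add_one_add_one_ne hn i).symm, sub_zero]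

lemma ofCycle_X (i : ZMod (2 * n + 1)) : ofCycle K n (X ((doubleEquiv n).symm i)) =
    genericSkew K n i (i + 1 : ZMod (2 * n + 1)) := by
  rw [ofCycle, aeval_X, Equiv.apply_symm_apply]

lemma ofCycle_genericCycle (hn : 1 ≤ n) {i j : ZMod (2 * n + 1)}
    (h : genericCycle K n i j ≠ 0) : ofCycle K n (genericCycle K n i j) = genericSkew K n i j := by
  by_cases h1 : j = i + 1
  · rw [h1, genericCycle_add_one hn, ofCycle_X]
  by_cases h2 : i = j + 1
  · rw [show genericCycle K n i j = -genericCycle K n j i from cycleMatrix_swap _ _ _, h2,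
      genericCycle_add_one hn, map_neg, ofCycle_X]
    exact (genericSkew_swap _ _).symm
  · simp [genericCycle, cycleMatrix, h1, h2] at h

lemma toCycle_ofCycle_X (hn : 1 ≤ n) (k : ZMod (2 * n + 1)) :
    toCycle K n (ofCycle K n (X k)) = X k := by
  have h : ofCycle K n (X k) =
      genericSkew K n (doubleEquiv n k) (doubleEquiv n k + 1 : ZMod (2 * n + 1)) := by
    rw [← ofCycle_X, Equiv.symm_apply_apply]
  rw [h]
  refine (toCycle_genericSkew _ _).trans ((genericCycle_add_one hn _).trans ?_)
  rw [Equiv.symm_apply_apply]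

lemma exists_ofCycle_X_eq (hn : 1 ≤ n) (k : ZMod (2 * n + 1)) :
    ∃ e, ∃ ε : K, ε ≠ 0 ∧ ofCycle K n (X k) = C ε * X e := by
  rw [← (doubleEquiv n).symm_apply_apply k, ofCycle_X]
  refine exists_genericSkew_eq fun h => add_one_add_one_ne hn (doubleEquiv n k) ?_
  have h' : doubleEquiv n k = doubleEquiv n k + 1 := h
  rw [← h', ← h']

variable (K) in
/-- The sub-maximal Pfaffians of the generic skew-symmetric matrix specialize to windows. -/
theorem exists_toricSpecialization [CharZero K] (hn : 1 ≤ n) : ∃ (a : K) (Y : Finset _), a ≠ 0 ∧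
    Nonempty (ToricSpecialization
      (fun k => C a * subPfaffian (genericSkew K n) (doubleEquiv n k)) Y) := by
  classical
  obtain ⟨a, ha, hP⟩ := exists_cyclePfaffian_eq (K := K) n
  choose e ε hε he using exists_ofCycle_X_eq (K := K) hn
  have hX : ∀ k, C (ε k) * toCycle K n (X (e k)) = X k := by
    intro k
    have := toCycle_ofCycle_X (K := K) hn k
    rwa [he, map_mul, algHom_C] at this
  refine ⟨a⁻¹, Finset.univ.filter fun x => toCycle K n (X x) = 0, inv_ne_zero ha, ⟨{
    π := toCycle K n
    ι := ofCycle K n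
    e := e
    ε := ε
    L := fun k j => -genericSkew K n (doubleEquiv n k + 1 : ZMod (2 * n + 1)) (doubleEquiv n j)
    π_ι := toCycle_ofCycle_X hn
    π_X := fun x hx => (Finset.mem_filter.1 hx).2
    ι_π := ?_
    π_P := ?_
    e_injective := ?_
    e_notMem := ?_
    ε_ne_zero := hε
    ι_X := he
    L_isHomogeneous := fun k j => (genericSkew_isHomogeneous _ _).neg
    sum_L_mul := ?_
    π_L := ?_ }⟩⟩
  · intro x hx
    have hx0 : toCycle K n (X x) ≠ 0 := by simpa using hx
    have hx1 : genericSkew K n x.1.1 x.1.2 = X x := genericSkew_of_lt x.2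
    rw [← hx1, toCycle_genericSkew] at hx0 ⊢
    exact ofCycle_genericCycle hn hx0
  · intro k
    have h : toCycle K n (subPfaffian (genericSkew K n) (doubleEquiv n k)) = C a * window K k :=
      (toCycle_subPfaffian _).trans (hP k)
    rw [map_mul, algHom_C, h, ← mul_assoc, algebraMap_eq, ← C_mul, inv_mul_cancel₀ ha, C_1,
      one_mul]
  · intro k l hkl
    have h : (X k : MvPolynomial (ZMod (2 * n + 1)) K) ∣ X l := by
      refine ⟨C (ε l * (ε k)⁻¹), ?_⟩
      rw [← hX k, ← hX l, hkl, mul_right_comm, ← C_mul]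
      congr 2
      field_simp [hε k]
    simpa [X_dvd_X] using h
  · intro k hk
    apply X_ne_zero (R := K) k
    rw [← hX k, (Finset.mem_filter.1 hk).2, mul_zero]
  · intro k
    have h := (doubleEquiv n).sum_comp fun i =>
      genericSkew K n (doubleEquiv n k + 1 : ZMod (2 * n + 1)) i *
        subPfaffian (genericSkew K n) i
    have h0 := h.trans (sum_mul_subPfaffian (genericSkew K n) genericSkew_swap genericSkew_self
      (doubleEquiv n k + 1 : ZMod (2 * n + 1)))
    rw [← neg_eq_zero, ← mul_eq_zero_of_right (C a⁻¹) h0, Finset.mul_sum, ← Finset.sum_neg_distrib]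
    refine Finset.sum_congr rfl fun j _ => ?_
    ring
  · intro k j
    have h : toCycle K n (genericSkew K n (doubleEquiv n k + 1 : ZMod (2 * n + 1))
        (doubleEquiv n j)) = (if j = k + 1 then X (k - n) else 0) - if j = k then X k else 0 :=
      (toCycle_genericSkew _ _).trans (genericCycle_row k j)
    rw [map_neg, h, neg_sub]

end GenericSkew

section Main

lemma span_range_unit_mul {R α β : Type*} [CommRing R] (f : α → R) (u : α → R)
    (hu : ∀ i, IsUnit (u i)) (σ : β ≃ α) :
    Ideal.span (Set.range fun k => u (σ k) * f (σ k)) = Ideal.span (Set.range f) := by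
  apply le_antisymm <;> rw [Ideal.span_le]
  · rintro _ ⟨k, rfl⟩
    exact Ideal.mul_mem_left _ _ (Ideal.subset_span ⟨σ k, rfl⟩)
  · rintro _ ⟨i, rfl⟩
    refine (Ideal.unit_mul_mem_iff_mem _ (hu i)).1 (Ideal.subset_span ⟨σ.symm i, ?_⟩)
    simp

end Main

/-- For `d ≥ 2n - 1`, the modules `Ext^{2s}_S(I^d, S)` are nonzero for all `0 ≤ s ≤ n`,
where `I` is the ideal of sub-maximal Pfaffians of the generic `(2n+1) × (2n+1)`
skew-symmetric matrix. -/
theorem ext_powers_submaximal_pfaffians_nonvanishing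
    (K : Type) [Field K] [CharZero K] (n : ℕ) (hn : 1 ≤ n)
    (X : Matrix (Fin (2 * n + 1)) (Fin (2 * n + 1))
      (MvPolynomial {p : Fin (2 * n + 1) × Fin (2 * n + 1) // p.1 < p.2} K))
    (hXlt : ∀ (i j : Fin (2 * n + 1)) (h : i < j), X i j = MvPolynomial.X ⟨(i, j), h⟩)
    (hXgt : ∀ (i j : Fin (2 * n + 1)) (h : j < i), X i j = -MvPolynomial.X ⟨(j, i), h⟩)
    (hXdiag : ∀ i, X i i = 0)
    (pf : Matrix (Fin (2 * n)) (Fin (2 * n))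
        (MvPolynomial {p : Fin (2 * n + 1) × Fin (2 * n + 1) // p.1 < p.2} K) →
      MvPolynomial {p : Fin (2 * n + 1) × Fin (2 * n + 1) // p.1 < p.2} K)
    (hpf : ∀ A, pf A = (((2 ^ n * Nat.factorial n : ℕ) : K)⁻¹) •
      ∑ σ : Equiv.Perm (Fin (2 * n)), (Equiv.Perm.sign σ : ℤ) •
        ∏ i : Fin n, A (σ ⟨2 * (i : ℕ), by omega⟩) (σ ⟨2 * (i : ℕ) + 1, by omega⟩))
    (I : Ideal (MvPolynomial {p : Fin (2 * n + 1) × Fin (2 * n + 1) // p.1 < p.2} K))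
    (hI : I = Ideal.span (Set.range fun k : Fin (2 * n + 1) =>
      pf (X.submatrix (Fin.succAbove k) (Fin.succAbove k))))
    (d : ℕ) (hd : 2 * n - 1 ≤ d) (s : ℕ) (hsn : s ≤ n) :
    Nontrivial
      (((Ext (MvPolynomial {p : Fin (2 * n + 1) × Fin (2 * n + 1) // p.1 < p.2} K) (ModuleCat (MvPolynomial {p : Fin (2 * n + 1) × Fin (2 * n + 1) // p.1 < p.2} K)) (2 * s)).obj
          (Opposite.op (ModuleCat.of (MvPolynomial {p : Fin (2 * n + 1) × Fin (2 * n + 1) // p.1 < p.2} K) (↥(I ^ d))))).obj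
        (ModuleCat.of (MvPolynomial {p : Fin (2 * n + 1) × Fin (2 * n + 1) // p.1 < p.2} K) (MvPolynomial {p : Fin (2 * n + 1) × Fin (2 * n + 1) // p.1 < p.2} K))) := by
  have hX : X = genericSkew K n := by
    ext1 i j
    rcases lt_trichotomy i j with h | rfl | h
    · rw [hXlt i j h, genericSkew_of_lt h]
    · rw [hXdiag, genericSkew_self]
    · rw [hXgt i j h, genericSkew_swap, genericSkew_of_lt h]
  obtain ⟨a, Y, ha, ⟨T⟩⟩ := exists_toricSpecialization K hn
  have hfac : ((2 ^ n * Nat.factorial n : ℕ) : K) ≠ 0 :=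
    Nat.cast_ne_zero.2 (mul_ne_zero (by positivity) (Nat.factorial_ne_zero n))
  have hI' : I = Ideal.span (Set.range fun k =>
      C a * subPfaffian (genericSkew K n) (doubleEquiv n k)) := by
    have h1 := span_range_unit_mul (fun k : Fin (2 * n + 1) =>
      pf (X.submatrix (Fin.succAbove k) (Fin.succAbove k)))
      (fun k => C (a * (2 ^ n * Nat.factorial n : ℕ)) * (-1) ^ (k : ℕ))
      (fun k => ((isUnit_iff_ne_zero.2 (mul_ne_zero ha hfac)).map C).mul
        (isUnit_one.neg.pow (k : ℕ))) (doubleEquiv n)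
    have h2 : ∀ k : Fin (2 * n + 1), C (a * (2 ^ n * Nat.factorial n : ℕ)) * (-1) ^ (k : ℕ) *
        pf (X.submatrix (Fin.succAbove k) (Fin.succAbove k)) =
        C a * subPfaffian (genericSkew K n) k := by
      intro k
      rw [hpf, hX, smul_eq_C_mul, subPfaffian, pfaffianSum, mul_right_comm, ← mul_assoc,
        ← C_mul, mul_assoc a, mul_inv_cancel₀ hfac, mul_one]
      ring
    rw [hI, ← h1]
    exact congrArg _ (congrArg _ (funext fun k => h2 (doubleEquiv n k)))
  rw [hI']
  rcases Nat.eq_zero_or_pos s with rfl | hs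
  · exact nontrivial_ext_zero_ideal (T.span_pow_ne_bot d)
  · obtain ⟨p, hp⟩ := T.exists_not_extVanishesAt hs hsn (by omega : 2 * s - 1 ≤ d)
    obtain ⟨j, hj⟩ : ∃ j, 2 * s = j + 1 := ⟨2 * s - 1, by omega⟩
    rw [hj] at hp ⊢
    exact nontrivial_ext_ideal_of_not_extVanishesAt hp
end

section
/- For every integer d ≥ 1: every S-linear map I^d → S is multiplication by a unique element of S (equivalently, the natural map S → Hom_S(I^d, S) sending f to the multiplication-by-f map is bijective), and moreover Ext^1_S(S/I^d, S) = 0. -/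
open MvPolynomial

/-- If the only common divisors of the elements of a nonzero ideal `J` of a UFD are units, then
every linear map `J → R` is multiplication by a unique element of `R`. -/
theorem bijective_smul_subtype_of_forall_dvd_isUnit {R : Type*} [CommRing R] [IsDomain R]
    [UniqueFactorizationMonoid R] (J : Ideal R) (hJ : J ≠ ⊥)
    (h : ∀ v : R, (∀ b ∈ J, v ∣ b) → IsUnit v) :
    Function.Bijective (fun f : R => (f • J.subtype : J →ₗ[R] R)) := by
  obtain ⟨a, haJ, ha⟩ := Submodule.exists_mem_ne_zero_of_ne_bot hJ
  constructor
  · intro f g hfg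
    have := LinearMap.congr_fun hfg ⟨a, haJ⟩
    simpa [ha] using this
  · intro φ
    have key (b : J) : φ b * a = φ ⟨a, haJ⟩ * b := by
      have : a • b = (b : R) • (⟨a, haJ⟩ : J) := Subtype.ext (mul_comm _ _)
      have := congrArg φ this
      simp only [map_smul, smul_eq_mul] at this
      linear_combination this
    obtain ⟨a', b', c, hrel, rfl, hb⟩ :=
      UniqueFactorizationMonoid.exists_reduced_factors a ha (φ ⟨a, haJ⟩)
    have hc : c ≠ 0 := left_ne_zero_of_mul ha
    have key' (b : J) : φ b * a' = b' * b := by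
      apply mul_left_cancel₀ hc
      linear_combination key b - (b : R) * hb
    obtain ⟨u, rfl⟩ : IsUnit a' := h a' fun b hbJ =>
      hrel.dvd_of_dvd_mul_left ⟨φ ⟨b, hbJ⟩, by rw [← key' ⟨b, hbJ⟩, mul_comm]⟩
    refine ⟨b' * ↑u⁻¹, LinearMap.ext fun b => ?_⟩
    have := key' b
    simp only [LinearMap.smul_apply, Submodule.subtype_apply, smul_eq_mul]
    calc b' * ↑u⁻¹ * (b : R) = φ b * u * ↑u⁻¹ := by rw [this]; ring
      _ = φ b := by simp

/-- If every linear map `J → R` is multiplication by a unique element of `R`, then every linear map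
to `R` from a submodule containing `J • P` extends to `P`. -/
theorem exists_linearMap_comp_eq_of_bijective_smul_subtype {R : Type*} [CommRing R] (J : Ideal R)
    (h : Function.Bijective (fun f : R => (f • J.subtype : J →ₗ[R] R)))
    {M P : Type*} [AddCommGroup M] [Module R M] [AddCommGroup P] [Module R P]
    (δ : M →ₗ[R] P) (hδ : ∀ a ∈ J, ∀ p : P, a • p ∈ LinearMap.range δ)
    (f : M →ₗ[R] R) (hf : LinearMap.ker δ ≤ LinearMap.ker f) :
    ∃ g : P →ₗ[R] R, g ∘ₗ δ = f := by
  obtain ⟨F, hF⟩ : ∃ F : LinearMap.range δ →ₗ[R] R, F ∘ₗ δ.rangeRestrict = f :=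
    ⟨(LinearMap.ker δ).liftQ f hf ∘ₗ δ.quotKerEquivRange.symm.toLinearMap, by
      ext m
      have : δ.quotKerEquivRange.symm (δ.rangeRestrict m) = (LinearMap.ker δ).mkQ m := by
        rw [LinearEquiv.symm_apply_eq]
        rfl
      simp [this]⟩
  let L (p : P) : J →ₗ[R] R := F ∘ₗ
    (LinearMap.codRestrict (LinearMap.range δ) (LinearMap.toSpanSingleton R P p ∘ₗ J.subtype)
      fun a => hδ a a.2 p)
  have hL (p : P) (a : J) : L p a = F ⟨(a : R) • p, hδ a a.2 p⟩ := rfl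
  choose c hc using fun p => h.2 (L p)
  have hc' (p : P) (a : J) : c p * a = L p a := LinearMap.congr_fun (hc p) a
  have huniq {x y : R} (hxy : ∀ a : J, x * a = y * a) : x = y :=
    h.1 (LinearMap.ext hxy)
  refine ⟨{ toFun := c, map_add' := fun p q => huniq fun a => ?_,
            map_smul' := fun r p => huniq fun a => ?_ }, LinearMap.ext fun m => huniq fun a => ?_⟩
  · rw [add_mul, hc', hc', hc', hL, hL, hL, ← map_add]
    congr 1
    exact Subtype.ext (smul_add _ _ _)
  · rw [RingHom.id_apply, smul_eq_mul, mul_assoc, hc', hc', hL, hL, ← smul_eq_mul r, ← map_smul]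
    congr 1
    exact Subtype.ext (smul_comm _ _ _)
  · change c (δ m) * a = f m * a
    rw [hc', hL, ← hF, mul_comm]
    exact F.map_smul (a : R) (δ.rangeRestrict m)

open CategoryTheory in
/-- If every linear map `J → R` is multiplication by a unique element of `R`, then
`Ext¹(R/J, R) = 0`. -/
theorem subsingleton_ext_one_quotient_of_bijective_smul_subtype {R : Type} [CommRing R]
    (J : Ideal R) (h : Function.Bijective (fun f : R => (f • J.subtype : J →ₗ[R] R))) :
    Subsingleton (((Ext R (ModuleCat R) 1).obj
      (Opposite.op (ModuleCat.of R (R ⧸ J)))).obj (ModuleCat.of R R)) := by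
  obtain ⟨P⟩ := (inferInstance :
    HasProjectiveResolution (ModuleCat.of R (R ⧸ J))).out
  rw [← ModuleCat.isZero_iff_subsingleton]
  refine Limits.IsZero.of_iso ?_ (P.isoExt 1 (ModuleCat.of R R))
  rw [← HomologicalComplex.exactAt_iff_isZero_homology,
    HomologicalComplex.exactAt_iff' _ 0 1 2 (by simp) (by simp),
    ShortComplex.moduleCat_exact_iff]
  intro (f : P.complex.X 1 ⟶ ModuleCat.of R R) (hf : P.complex.d 2 1 ≫ f = 0)
  have hexact₁ := (ShortComplex.moduleCat_exact_iff _).1 (P.exact_succ 0)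
  have hexact₀ := (ShortComplex.moduleCat_exact_iff _).1 P.exact₀
  have htors (a : R) (ha : a ∈ J) (x : R ⧸ J) : a • x = 0 := by
    obtain ⟨q, rfl⟩ := Ideal.Quotient.mk_surjective x
    rw [← Ideal.Quotient.mk_eq_mk, ← Submodule.Quotient.mk_smul, Submodule.Quotient.mk_eq_zero]
    exact J.mul_mem_right q ha
  obtain ⟨g, hg⟩ := exists_linearMap_comp_eq_of_bijective_smul_subtype J h
    (P.complex.d 1 0).hom (fun a ha p => by
      obtain ⟨m, hm⟩ := hexact₀ (a • p) (by
        rw [map_smul]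
        exact htors a ha _)
      exact ⟨m, hm⟩) f.hom (fun m hm => by
      obtain ⟨q, hq⟩ := hexact₁ m hm
      rw [LinearMap.mem_ker, ← hq]
      exact LinearMap.congr_fun (congrArg ModuleCat.Hom.hom hf) q)
  exact ⟨ModuleCat.ofHom g, ModuleCat.hom_ext hg⟩

/-- The block diagonal matrix with `2 × 2` alternating blocks `!![0, 1; -1, 0]`. -/
def symplecticBlocks (ι R : Type*) [DecidableEq ι] [CommRing R] :
    Matrix (ι × Fin 2) (ι × Fin 2) R :=
  fun a b => if a.1 = b.1 then ((b.2 : ℕ) : R) - ((a.2 : ℕ) : R) else 0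

theorem symplecticBlocks_swap {ι R : Type*} [DecidableEq ι] [CommRing R] (a b : ι × Fin 2) :
    symplecticBlocks ι R a b = -symplecticBlocks ι R b a := by
  unfold symplecticBlocks
  by_cases h : a.1 = b.1 <;> simp [h, eq_comm]

/-- Each term of the Pfaffian of the standard symplectic matrix is `0` or `1`. -/
theorem sign_smul_prod_symplecticBlocks {ι R : Type*} [DecidableEq ι] [Fintype ι] [CommRing R]
    (σ : Equiv.Perm (ι × Fin 2)) :
    (Equiv.Perm.sign σ : ℤ) • ∏ i, symplecticBlocks ι R (σ (i, 0)) (σ (i, 1)) = 0 ∨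
    (Equiv.Perm.sign σ : ℤ) • ∏ i, symplecticBlocks ι R (σ (i, 0)) (σ (i, 1)) = 1 := by
  by_cases h : ∀ i, (σ (i, 0)).1 = (σ (i, 1)).1
  · right
    have hfst (i : ι) (a : Fin 2) : (σ (i, a)).1 = (σ (i, 0)).1 := by
      fin_cases a
      · rfl
      · exact (h i).symm
    have hρ (i : ι) : Function.Bijective fun a => (σ (i, a)).2 := by
      rw [← Finite.injective_iff_bijective]
      intro a b hab
      have : σ (i, a) = σ (i, b) := Prod.ext ((hfst i a).trans (hfst i b).symm) hab
      simpa using this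
    have hπ : Function.Bijective fun i => (σ (i, 0)).1 := by
      rw [← Finite.surjective_iff_bijective]
      intro j
      refine ⟨(σ.symm (j, 0)).1, ?_⟩
      simp [← hfst _ (σ.symm (j, 0)).2]
    let ρ (i : ι) : Equiv.Perm (Fin 2) := Equiv.ofBijective _ (hρ i)
    let π : Equiv.Perm ι := Equiv.ofBijective _ hπ
    have hσ : σ = Equiv.prodCongrLeft (fun _ => π) * Equiv.prodCongrRight ρ := by
      ext ⟨i, a⟩
      · exact hfst i a
      · rfl
    have hsign : Equiv.Perm.sign σ = ∏ i, Equiv.Perm.sign (ρ i) := by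
      rw [hσ, Equiv.Perm.sign_mul, Equiv.Perm.sign_prodCongrLeft, Equiv.Perm.sign_prodCongrRight]
      simp
    have hterm (τ : Equiv.Perm (Fin 2)) :
        (Equiv.Perm.sign τ : ℤ) * (((τ 1 : ℕ) : ℤ) - ((τ 0 : ℕ) : ℤ)) = 1 := by
      revert τ
      decide
    rw [hsign, zsmul_eq_mul]
    push_cast
    rw [← Finset.prod_mul_distrib]
    refine Finset.prod_eq_one fun i _ => ?_
    have := congrArg (Int.cast : ℤ → R) (hterm (ρ i))
    push_cast at this
    rw [← this, symplecticBlocks, if_pos (h i)]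
    rfl
  · left
    push Not at h
    obtain ⟨i, hi⟩ := h
    rw [Finset.prod_eq_zero (Finset.mem_univ i) (by simp [symplecticBlocks, hi]), smul_zero]

/-- The Pfaffian sum of the standard symplectic matrix does not vanish. -/
theorem sum_sign_smul_prod_symplecticBlocks_ne_zero {ι R : Type*} [DecidableEq ι] [Fintype ι]
    [CommRing R] [CharZero R] :
    ∑ σ : Equiv.Perm (ι × Fin 2), (Equiv.Perm.sign σ : ℤ) •
      ∏ i, symplecticBlocks ι R (σ (i, 0)) (σ (i, 1)) ≠ 0 := by
  classical
  have : Nontrivial R := ⟨0, 1, by exact_mod_cast (zero_ne_one : (0 : ℕ) ≠ 1)⟩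
  set t : Equiv.Perm (ι × Fin 2) → R := fun σ => (Equiv.Perm.sign σ : ℤ) •
      ∏ i, symplecticBlocks ι R (σ (i, 0)) (σ (i, 1)) with ht
  have hsum : ∑ σ, t σ = ∑ σ, if t σ = 1 then (1 : R) else 0 :=
    Finset.sum_congr rfl fun σ _ => by
      rcases sign_smul_prod_symplecticBlocks (R := R) σ with h | h
      · simp [show t σ = 0 from h]
      · simp [show t σ = 1 from h]
  rw [hsum, Finset.sum_boole, Nat.cast_ne_zero, Finset.card_ne_zero]
  exact ⟨1, by simp [ht, symplecticBlocks]⟩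

/-- There is a `2n × 2n` alternating matrix whose Pfaffian sum does not vanish. -/
theorem exists_skew_sum_sign_smul_prod_ne_zero (R : Type*) [CommRing R] [CharZero R] (n : ℕ)
    (heven : ∀ i : Fin n, 2 * (i : ℕ) < 2 * n) (hodd : ∀ i : Fin n, 2 * (i : ℕ) + 1 < 2 * n) :
    ∃ A : Matrix (Fin (2 * n)) (Fin (2 * n)) R, (∀ i j, A i j = -A j i) ∧ (∀ i, A i i = 0) ∧
      ∑ σ : Equiv.Perm (Fin (2 * n)), (Equiv.Perm.sign σ : ℤ) •
        ∏ i : Fin n, A (σ ⟨2 * (i : ℕ), heven i⟩) (σ ⟨2 * (i : ℕ) + 1, hodd i⟩) ≠ 0 := by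
  let e : Fin n × Fin 2 ≃ Fin (2 * n) := finProdFinEquiv.trans (finCongr (mul_comm n 2))
  have he0 (i : Fin n) (h : 2 * (i : ℕ) < 2 * n) : e.symm ⟨2 * i, h⟩ = (i, 0) := by
    rw [Equiv.symm_apply_eq]
    simp [e, Fin.ext_iff]
  have he1 (i : Fin n) (h : 2 * (i : ℕ) + 1 < 2 * n) : e.symm ⟨2 * i + 1, h⟩ = (i, 1) := by
    rw [Equiv.symm_apply_eq]
    simp [e, Fin.ext_iff, add_comm]
  refine ⟨fun i j => symplecticBlocks (Fin n) R (e.symm i) (e.symm j),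
    fun i j => symplecticBlocks_swap _ _, fun i => by simp [symplecticBlocks], ?_⟩
  convert sum_sign_smul_prod_symplecticBlocks_ne_zero (ι := Fin n) (R := R) using 1
  rw [← Equiv.sum_comp e.permCongr]
  refine Finset.sum_congr rfl fun σ _ => ?_
  simp [Equiv.Perm.sign_permCongr, Equiv.permCongr_apply, he0, he1]

theorem MvPolynomial.vars_subset_of_dvd {σ R : Type*} [CommRing R] [IsDomain R]
    {p q : MvPolynomial σ R} (h : p ∣ q) (hq : q ≠ 0) : p.vars ⊆ q.vars := by
  classical
  obtain ⟨r, rfl⟩ := h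
  intro x hx
  rw [MvPolynomial.vars_def, Multiset.mem_toFinset] at hx ⊢
  rw [MvPolynomial.degrees_mul_eq (left_ne_zero_of_mul hq) (right_ne_zero_of_mul hq)]
  exact Multiset.mem_add.2 (Or.inl hx)

/-- For `d ≥ 1`: every `S`-linear map `I^d → S` is multiplication by a unique element
of `S` (i.e. the natural map `S → Hom_S(I^d, S)` is bijective), and
`Ext^1_S(S/I^d, S) = 0`, where `I` is the ideal of sub-maximal Pfaffians of the
generic `(2n+1) × (2n+1)` skew-symmetric matrix. -/
theorem hom_powers_submaximal_pfaffians_and_ext_one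
    (K : Type) [Field K] [CharZero K] (n : ℕ) (hn : 1 ≤ n)
    (X : Matrix (Fin (2 * n + 1)) (Fin (2 * n + 1))
      (MvPolynomial {p : Fin (2 * n + 1) × Fin (2 * n + 1) // p.1 < p.2} K))
    (hXlt : ∀ (i j : Fin (2 * n + 1)) (h : i < j), X i j = MvPolynomial.X ⟨(i, j), h⟩)
    (hXgt : ∀ (i j : Fin (2 * n + 1)) (h : j < i), X i j = -MvPolynomial.X ⟨(j, i), h⟩)
    (hXdiag : ∀ i, X i i = 0)
    (pf : Matrix (Fin (2 * n)) (Fin (2 * n))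
        (MvPolynomial {p : Fin (2 * n + 1) × Fin (2 * n + 1) // p.1 < p.2} K) →
      MvPolynomial {p : Fin (2 * n + 1) × Fin (2 * n + 1) // p.1 < p.2} K)
    (hpf : ∀ A, pf A = (((2 ^ n * Nat.factorial n : ℕ) : K)⁻¹) •
      ∑ σ : Equiv.Perm (Fin (2 * n)), (Equiv.Perm.sign σ : ℤ) •
        ∏ i : Fin n, A (σ ⟨2 * (i : ℕ), by omega⟩) (σ ⟨2 * (i : ℕ) + 1, by omega⟩))
    (I : Ideal (MvPolynomial {p : Fin (2 * n + 1) × Fin (2 * n + 1) // p.1 < p.2} K))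
    (hI : I = Ideal.span (Set.range fun k : Fin (2 * n + 1) =>
      pf (X.submatrix (Fin.succAbove k) (Fin.succAbove k))))
    (d : ℕ) (hd : 1 ≤ d) :
    Function.Bijective (fun f : MvPolynomial {p : Fin (2 * n + 1) × Fin (2 * n + 1) // p.1 < p.2} K =>
        (f • (I ^ d).subtype : ↥(I ^ d) →ₗ[MvPolynomial {p : Fin (2 * n + 1) × Fin (2 * n + 1) // p.1 < p.2} K] MvPolynomial {p : Fin (2 * n + 1) × Fin (2 * n + 1) // p.1 < p.2} K)) ∧
    Subsingleton
      (((Ext (MvPolynomial {p : Fin (2 * n + 1) × Fin (2 * n + 1) // p.1 < p.2} K) (ModuleCat (MvPolynomial {p : Fin (2 * n + 1) × Fin (2 * n + 1) // p.1 < p.2} K)) 1).obj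
          (Opposite.op (ModuleCat.of (MvPolynomial {p : Fin (2 * n + 1) × Fin (2 * n + 1) // p.1 < p.2} K) (MvPolynomial {p : Fin (2 * n + 1) × Fin (2 * n + 1) // p.1 < p.2} K ⧸ (I ^ d))))).obj
        (ModuleCat.of (MvPolynomial {p : Fin (2 * n + 1) × Fin (2 * n + 1) // p.1 < p.2} K) (MvPolynomial {p : Fin (2 * n + 1) × Fin (2 * n + 1) // p.1 < p.2} K))) := by
  classical
  set p : Fin (2 * n + 1) →
      MvPolynomial {p : Fin (2 * n + 1) × Fin (2 * n + 1) // p.1 < p.2} K :=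
    fun k => pf (X.submatrix (Fin.succAbove k) (Fin.succAbove k)) with hp
  have hpne (k) : p k ≠ 0 := by
    obtain ⟨A, hskew, hdiag, hA⟩ := exists_skew_sum_sign_smul_prod_ne_zero K n
      (fun i => by omega) (fun i => by omega)
    have : Nonempty (Fin (2 * n)) := ⟨⟨0, by omega⟩⟩
    set r := Function.invFun k.succAbove
    have hr (i) : r (k.succAbove i) = i :=
      Function.leftInverse_invFun Fin.succAbove_right_injective i
    let ev := aeval (R := K)
      (fun q : {p : Fin (2 * n + 1) × Fin (2 * n + 1) // p.1 < p.2} => A (r q.1.1) (r q.1.2))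
    have hX (i j) : ev (X i j) = A (r i) (r j) := by
      rcases lt_trichotomy i j with h | rfl | h
      · simp [hXlt i j h, ev]
      · simp [hXdiag, hdiag]
      · simp [hXgt i j h, ev, hskew (r i)]
    intro h0
    have h1 : ev (p k) = 0 := by rw [h0, map_zero]
    simp only [hp, hpf, map_smul, map_sum, map_prod, map_zsmul, Matrix.submatrix_apply, hX, hr,
      smul_eq_zero] at h1
    refine h1.elim (fun h => ?_) hA
    exact inv_ne_zero (Nat.cast_ne_zero.2 (by positivity)) h
  have hpvars (k) : p k ∈ supported K {q | q.1.1 ≠ k ∧ q.1.2 ≠ k} := by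
    have hX (i j) : X (k.succAbove i) (k.succAbove j) ∈
        supported K {q : {p : Fin (2 * n + 1) × Fin (2 * n + 1) // p.1 < p.2} |
          q.1.1 ≠ k ∧ q.1.2 ≠ k} := by
      rcases lt_trichotomy (k.succAbove i) (k.succAbove j) with h | h | h
      · rw [hXlt _ _ h, X_mem_supported]
        exact ⟨k.succAbove_ne i, k.succAbove_ne j⟩
      · rw [h, hXdiag]
        exact zero_mem _
      · rw [hXgt _ _ h]
        refine neg_mem ?_
        rw [X_mem_supported]
        exact ⟨k.succAbove_ne j, k.succAbove_ne i⟩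
    simp only [hp, hpf]
    exact Subalgebra.smul_mem _ (sum_mem fun σ _ => zsmul_mem (prod_mem fun i _ => hX _ _) _) _
  have hpI (k) : p k ^ d ∈ I ^ d := Ideal.pow_mem_pow (hI ▸ Ideal.subset_span ⟨k, rfl⟩) d
  have hbij := bijective_smul_subtype_of_forall_dvd_isUnit (I ^ d)
    (fun h => pow_ne_zero d (hpne 0) (by simpa [h] using hpI 0)) (fun v hv => by
      have hvars : v.vars = ∅ := by
        refine Finset.eq_empty_of_forall_notMem fun x hx => ?_
        have hxp := vars_subset_of_dvd (hv _ (hpI x.1.1)) (pow_ne_zero d (hpne _)) hx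
        exact (mem_supported.1 (pow_mem (hpvars x.1.1) d) hxp).1 rfl
      rw [vars_eq_empty_iff_eq_C] at hvars
      have hv0 : coeff 0 v ≠ 0 := fun h0 => by
        rw [h0, map_zero] at hvars
        exact pow_ne_zero d (hpne 0) (zero_dvd_iff.1 (hvars ▸ hv _ (hpI 0)))
      rw [hvars]
      exact (isUnit_iff_ne_zero.2 hv0).map C)
  exact ⟨hbij, subsingleton_ext_one_quotient_of_bijective_smul_subtype (I ^ d) hbij⟩
end
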